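/- arXiv:1711.10649 — 2 statements merged into one kernel-verified Lean document; each statement's English description precedes it below -/
import Mathlib

section
/- Let X_1, X_2, … be an i.i.d. sequence of real random variables under the sublinear expectation 𝔼 with 𝔼[X_1²] < ∞, and set μ̄ := 𝔼[X_1], μ_ := −𝔼[−X_1], σ̄² := sup_{θ∈Θ} E_θ[(X_1 − E_θ[X_1])²]. Let φ : ℝ → ℝ be differentiable with Lipschitz derivative, and write ‖φ''‖ for the Lipschitz constant of φ'. Define recursively μ_i := μ̄ if φ'((Σ_{j=1}^{i−1}(X_j − μ_j))/n) ≥ 0 and μ_i := μ_ otherwise. Then for every n ≥ 1, |𝔼[φ((Σ_{i=1}^n (X_i − μ_i))/n)] − φ(0)| ≤ C_0 ‖φ''‖/n, where C_0 := (σ̄² + (μ̄ − μ_)²)/2. -/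
open MeasureTheory

/-- The sublinear expectation `𝔼[f] = sup_θ E_θ[f]` associated with a family of measures. -/
noncomputable def SE {Ω Θ : Type*} [MeasurableSpace Ω] (P : Θ → Measure Ω) (f : Ω → ℝ) : ℝ :=
  ⨆ θ, ∫ ω, f ω ∂(P θ)

/-- `X` and `Y` are identically distributed under the sublinear expectation. -/
def SEIdentDistrib {Ω Θ : Type*} [MeasurableSpace Ω] (P : Θ → Measure Ω) (X Y : Ω → ℝ) : Prop :=
  ∀ φ : ℝ → ℝ, Continuous φ → (∃ C, ∀ x, |φ x| ≤ C) →
    SE P (fun ω => φ (X ω)) = SE P (fun ω => φ (Y ω))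

/-- `Y` is independent of the random vector `X` under the sublinear expectation. -/
def SEIndepOf {Ω Θ : Type*} [MeasurableSpace Ω] (P : Θ → Measure Ω) {m : ℕ}
    (Y : Ω → ℝ) (X : Ω → Fin m → ℝ) : Prop :=
  ∀ φ : (Fin m → ℝ) → ℝ → ℝ,
    Continuous (fun p : (Fin m → ℝ) × ℝ => φ p.1 p.2) →
    (∃ C, ∀ x y, |φ x y| ≤ C) →
    SE P (fun ω => φ (X ω) (Y ω)) = SE P (fun ω => SE P (fun ω' => φ (X ω) (Y ω')))

/-- `X 0, X 1, …` is i.i.d. under the sublinear expectation. -/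
def SEiid {Ω Θ : Type*} [MeasurableSpace Ω] (P : Θ → Measure Ω) (X : ℕ → Ω → ℝ) : Prop :=
  ∀ i : ℕ, SEIdentDistrib P (X (i + 1)) (X 0) ∧
    SEIndepOf P (X (i + 1)) (fun ω (j : Fin (i + 1)) => X (j : ℕ) ω)

/-- The recursively centered partial sums `S_i = Σ_{j=1}^i (X_j − μ_j)`, where
`μ_{i+1} = μ̄` if `φ'(S_i/n) ≥ 0` and `μ_{i+1} = μ_` otherwise. -/
noncomputable def Srec {Ω : Type*} (X : ℕ → Ω → ℝ) (φ' : ℝ → ℝ) (μbar μlow : ℝ) (n : ℕ) :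
    ℕ → Ω → ℝ
  | 0 => fun _ => 0
  | (i + 1) => fun ω =>
      Srec X φ' μbar μlow n i ω +
        (X i ω - if 0 ≤ φ' (Srec X φ' μbar μlow n i ω / n) then μbar else μlow)

open Filter Topology
open scoped BoundedContinuousFunction

section Bounded

variable {E : Type*} [TopologicalSpace E]

lemma integrable_of_abs_le {Ω : Type*} [MeasurableSpace Ω] {μ : Measure Ω} [IsFiniteMeasure μ]
    {a : Ω → ℝ} {A : ℝ} (ha : AEStronglyMeasurable a μ) (hA : ∀ x, |a x| ≤ A) :
    Integrable a μ :=
  Integrable.of_bound ha A (Eventually.of_forall hA)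

lemma abs_integral_le_of_abs_le {Ω : Type*} [MeasurableSpace Ω] {μ : Measure Ω}
    [IsProbabilityMeasure μ] {a : Ω → ℝ} {A : ℝ} (hA : ∀ x, |a x| ≤ A) :
    |∫ x, a x ∂μ| ≤ A := by
  have := norm_integral_le_of_norm_le_const (μ := μ) (f := a) (C := A) (Eventually.of_forall hA)
  simpa using this

lemma integral_le_SE {Ω Θ : Type*} [MeasurableSpace Ω] {P : Θ → Measure Ω}
    [∀ θ, IsProbabilityMeasure (P θ)] {f : Ω → ℝ} {C : ℝ} (hC : ∀ x, |f x| ≤ C) (θ : Θ) :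
    ∫ x, f x ∂P θ ≤ SE P f := by
  refine le_ciSup (f := fun θ => ∫ x, f x ∂P θ) ⟨C, ?_⟩ θ
  rintro _ ⟨θ, rfl⟩
  exact (le_abs_self _).trans (abs_integral_le_of_abs_le hC)

lemma abs_boundedContinuous_le (H : E →ᵇ ℝ) (x : E) : |H x| ≤ ‖H‖ := H.norm_coe_le_norm x

lemma integral_boundedContinuous_le_SE {E Θ : Type*} [TopologicalSpace E] [MeasurableSpace E]
    {ν : Θ → Measure E} [∀ θ, IsProbabilityMeasure (ν θ)] (H : E →ᵇ ℝ) (θ : Θ) :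
    ∫ x, H x ∂ν θ ≤ SE ν H :=
  integral_le_SE (abs_boundedContinuous_le H) θ

/-- Continuous functions decreasing to the indicator of `{0 ≤ u}`. -/
noncomputable def ramp (u : E → ℝ) (hu : Continuous u) (k : ℕ) : E →ᵇ ℝ :=
  BoundedContinuousFunction.ofNormedAddCommGroup (fun x => max 0 (min 1 (1 + k * u x)))
    (by fun_prop) 1 (fun x => by
      rw [Real.norm_eq_abs, abs_of_nonneg (le_max_left _ _)]
      exact max_le zero_le_one (min_le_left _ _))

lemma ramp_apply (u : E → ℝ) (hu : Continuous u) (k : ℕ) (x : E) :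
    ramp u hu k x = max 0 (min 1 (1 + k * u x)) := rfl

lemma ramp_le_one (u : E → ℝ) (hu : Continuous u) (k : ℕ) (x : E) : ramp u hu k x ≤ 1 :=
  max_le zero_le_one (min_le_left _ _)

lemma ramp_nonneg (u : E → ℝ) (hu : Continuous u) (k : ℕ) (x : E) : 0 ≤ ramp u hu k x :=
  le_max_left _ _

lemma indicator_le_ramp (u : E → ℝ) (hu : Continuous u) (k : ℕ) (x : E) :
    (if 0 ≤ u x then (1 : ℝ) else 0) ≤ ramp u hu k x := by
  split_ifs with h
  · have : (0 : ℝ) ≤ k * u x := by positivity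
    rw [ramp_apply]
    exact le_max_of_le_right (le_min le_rfl (by linarith))
  · exact ramp_nonneg u hu k x

lemma tendsto_ramp (u : E → ℝ) (hu : Continuous u) (x : E) :
    Tendsto (fun k => ramp u hu k x) atTop (𝓝 (if 0 ≤ u x then (1 : ℝ) else 0)) := by
  split_ifs with h
  · refine tendsto_const_nhds.congr fun k => ?_
    have := indicator_le_ramp u hu k x
    rw [if_pos h] at this
    exact le_antisymm this (ramp_le_one u hu k x)
  · push Not at h
    refine tendsto_const_nhds.congr' ?_
    obtain ⟨N, hN⟩ := exists_nat_gt (1 / (-u x))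
    filter_upwards [eventually_ge_atTop N] with k hk
    have hk' : (N : ℝ) ≤ k := by exact_mod_cast hk
    have h1 : 1 < k * (-u x) := by
      rw [← div_lt_iff₀ (by linarith)]; linarith
    rw [ramp_apply, max_eq_left]
    exact (min_le_right _ _).trans (by linarith)

end Bounded

section Approximation

variable {E Θ : Type*} [TopologicalSpace E] [MeasurableSpace E] [OpensMeasurableSpace E]

/-- The indices at which a bounded continuous function comes within `η` of its sublinear
expectation. -/
def nearMax (ν : Θ → Measure E) (H : E →ᵇ ℝ) (η : ℝ) : Set Θ :=
  {θ | SE ν H - η < ∫ x, H x ∂ν θ}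

/-- A bounded measurable function which, after shrinking any set of near-maximizers to a smaller
one, is uniformly close in `L¹` to a bounded continuous function. -/
def Approximable (ν : Θ → Measure E) (a : E → ℝ) : Prop :=
  Measurable a ∧ (∃ A, ∀ x, |a x| ≤ A) ∧
    ∀ (H : E →ᵇ ℝ) (η : ℝ), 0 < η → ∀ ε : ℝ, 0 < ε →
      ∃ (H' : E →ᵇ ℝ) (η' : ℝ) (g : E →ᵇ ℝ), 0 < η' ∧ nearMax ν H' η' ⊆ nearMax ν H η ∧
        ∀ θ ∈ nearMax ν H' η', ∫ x, |a x - g x| ∂ν θ ≤ ε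

lemma approximable_boundedContinuous {ν : Θ → Measure E} (g : E →ᵇ ℝ) : Approximable ν g :=
  ⟨g.continuous.measurable, ⟨‖g‖, abs_boundedContinuous_le g⟩,
    fun H η hη ε hε => ⟨H, η, g, hη, subset_rfl, fun θ _ => by simpa using hε.le⟩⟩

variable {ν : Θ → Measure E} [∀ θ, IsProbabilityMeasure (ν θ)]

lemma integrable_abs_sub {a : E → ℝ} {A : ℝ} (ha : Measurable a) (hA : ∀ x, |a x| ≤ A)
    (g : E →ᵇ ℝ) (θ : Θ) : Integrable (fun x => |a x - g x|) (ν θ) :=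
  ((integrable_of_abs_le ha.aestronglyMeasurable hA).sub (g.integrable (ν θ))).abs

lemma Approximable.add {a b : E → ℝ} (ha : Approximable ν a) (hb : Approximable ν b) :
    Approximable ν (fun x => a x + b x) := by
  obtain ⟨ham, ⟨A, hA⟩, ha⟩ := ha
  obtain ⟨hbm, ⟨B, hB⟩, hb⟩ := hb
  refine ⟨ham.add hbm, ⟨A + B, fun x => (abs_add_le _ _).trans (add_le_add (hA x) (hB x))⟩, ?_⟩
  intro H η hη ε hε
  obtain ⟨H₁, η₁, h, hη₁, hsub₁, hh⟩ := hb H η hη (ε / 2) (by positivity)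
  obtain ⟨H₂, η₂, g, hη₂, hsub₂, hg⟩ := ha H₁ η₁ hη₁ (ε / 2) (by positivity)
  refine ⟨H₂, η₂, g + h, hη₂, hsub₂.trans hsub₁, fun θ hθ => ?_⟩
  have ig := integrable_abs_sub (ν := ν) ham hA g θ
  have ih := integrable_abs_sub (ν := ν) hbm hB h θ
  calc ∫ x, |a x + b x - (g + h) x| ∂ν θ ≤ ∫ x, (|a x - g x| + |b x - h x|) ∂ν θ := by
        refine integral_mono_of_nonneg (Eventually.of_forall fun x => abs_nonneg _) (ig.add ih)
          (Eventually.of_forall fun x => ?_)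
        have : a x + b x - (g + h) x = (a x - g x) + (b x - h x) := by
          simp only [BoundedContinuousFunction.coe_add, Pi.add_apply]; ring
        simpa only [this] using abs_add_le _ _
    _ = ∫ x, |a x - g x| ∂ν θ + ∫ x, |b x - h x| ∂ν θ := integral_add ig ih
    _ ≤ ε := by linarith [hg θ hθ, hh θ (hsub₂ hθ)]

lemma Approximable.mul {a b : E → ℝ} (ha : Approximable ν a) (hb : Approximable ν b) :
    Approximable ν (fun x => a x * b x) := by
  obtain ⟨ham, ⟨A, hA⟩, ha⟩ := ha
  obtain ⟨hbm, ⟨B, hB⟩, hb⟩ := hb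
  refine ⟨ham.mul hbm, ⟨A * B, fun x => ?_⟩, ?_⟩
  · rw [abs_mul]
    exact mul_le_mul (hA x) (hB x) (abs_nonneg _) ((abs_nonneg _).trans (hA x))
  intro H η hη ε hε
  obtain ⟨H₁, η₁, h, hη₁, hsub₁, hh⟩ := hb H η hη (ε / (2 * (|A| + 1))) (by positivity)
  obtain ⟨H₂, η₂, g, hη₂, hsub₂, hg⟩ := ha H₁ η₁ hη₁ (ε / (2 * (‖h‖ + 1))) (by positivity)
  refine ⟨H₂, η₂, g * h, hη₂, hsub₂.trans hsub₁, fun θ hθ => ?_⟩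
  have ig := (integrable_abs_sub (ν := ν) ham hA g θ).const_mul (‖h‖ + 1)
  have ih := (integrable_abs_sub (ν := ν) hbm hB h θ).const_mul (|A| + 1)
  calc ∫ x, |a x * b x - (g * h) x| ∂ν θ
      ≤ ∫ x, ((‖h‖ + 1) * |a x - g x| + (|A| + 1) * |b x - h x|) ∂ν θ := by
        refine integral_mono_of_nonneg (Eventually.of_forall fun x => abs_nonneg _) (ig.add ih)
          (Eventually.of_forall fun x => ?_)
        have : a x * b x - (g * h) x = h x * (a x - g x) + a x * (b x - h x) := by
          simp only [BoundedContinuousFunction.coe_mul, Pi.mul_apply]; ring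
        simp only [this]
        refine (abs_add_le _ _).trans ?_
        rw [abs_mul, abs_mul]
        have h1 : |h x| ≤ ‖h‖ + 1 := (abs_boundedContinuous_le h x).trans (by linarith)
        have h2 : |a x| ≤ |A| + 1 := (hA x).trans ((le_abs_self A).trans (by linarith))
        gcongr
    _ = (‖h‖ + 1) * ∫ x, |a x - g x| ∂ν θ + (|A| + 1) * ∫ x, |b x - h x| ∂ν θ := by
        rw [integral_add ig ih, integral_const_mul, integral_const_mul]
    _ ≤ (‖h‖ + 1) * (ε / (2 * (‖h‖ + 1))) + (|A| + 1) * (ε / (2 * (|A| + 1))) := by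
        gcongr
        · exact hg θ hθ
        · exact hh θ (hsub₂ hθ)
    _ = ε := by
        have : ‖h‖ + 1 ≠ 0 := by positivity
        have : |A| + 1 ≠ 0 := by positivity
        field_simp
        ring

lemma measurable_indicator_nonneg {u : E → ℝ} (hu : Continuous u) :
    Measurable fun x => if 0 ≤ u x then (1 : ℝ) else 0 :=
  Measurable.ite (measurableSet_le measurable_const hu.measurable) measurable_const
    measurable_const

lemma approximable_indicator [Nonempty Θ] {u : E → ℝ} (hu : Continuous u) :
    Approximable ν (fun x => if 0 ≤ u x then (1 : ℝ) else 0) := by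
  have hm := measurable_indicator_nonneg hu
  have hb : ∀ x, |if 0 ≤ u x then (1 : ℝ) else 0| ≤ 1 := fun x => by split_ifs <;> simp
  refine ⟨hm, ⟨1, hb⟩, fun H η hη ε hε => ?_⟩
  have hint : ∀ θ, Integrable (fun x => if 0 ≤ u x then (1 : ℝ) else 0) (ν θ) := fun θ =>
    integrable_of_abs_le hm.aestronglyMeasurable hb
  set l : ℝ := η / 2 with hl
  have hl0 : 0 < l := by positivity
  set F : ℕ → E →ᵇ ℝ := fun k => H - l • ramp u hu k with hF
  have hFint : ∀ k θ, ∫ x, F k x ∂ν θ = ∫ x, H x ∂ν θ - l * ∫ x, ramp u hu k x ∂ν θ := by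
    intro k θ
    rw [← integral_const_mul, ← integral_sub (H.integrable _)
      ((BoundedContinuousFunction.integrable _ _).const_mul _)]
    rfl
  have hr0 : ∀ k θ, 0 ≤ ∫ x, ramp u hu k x ∂ν θ := fun k θ =>
    integral_nonneg (ramp_nonneg u hu k)
  have hr1 : ∀ k θ, ∫ x, ramp u hu k x ∂ν θ ≤ 1 := fun k θ =>
    (le_abs_self _).trans (abs_integral_le_of_abs_le fun x => by
      rw [abs_of_nonneg (ramp_nonneg u hu k x)]; exact ramp_le_one u hu k x)
  have hFH : ∀ k, SE ν (F k) ≤ SE ν H := fun k => ciSup_le fun θ => by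
    rw [hFint]
    nlinarith [integral_boundedContinuous_le_SE (ν := ν) H θ, hr0 k θ]
  have hHF : ∀ k, SE ν H ≤ SE ν (F k) + l := fun k => ciSup_le fun θ => by
    have := integral_boundedContinuous_le_SE (ν := ν) (F k) θ
    rw [hFint] at this
    nlinarith [hr1 k θ]
  have hbdd : BddAbove (Set.range fun k => SE ν (F k)) :=
    ⟨SE ν H, by rintro _ ⟨k, rfl⟩; exact hFH k⟩
  set V : ℝ := ⨆ k, SE ν (F k) with hV
  set η' : ℝ := min (η / 2) (l * ε / 2) with hη'
  have hη'0 : 0 < η' := by positivity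
  obtain ⟨k, hk⟩ : ∃ k, V - l * ε / 2 < SE ν (F k) :=
    exists_lt_of_lt_ciSup (by have : 0 < l * ε / 2 := by positivity
                              linarith)
  refine ⟨F k, η', ramp u hu k, hη'0, fun θ hθ => ?_, fun θ hθ => ?_⟩
  · simp only [nearMax, Set.mem_ofPred_eq] at hθ ⊢
    rw [hFint] at hθ
    have := min_le_left (η / 2) (l * ε / 2)
    nlinarith [hHF k, hr0 k θ]
  · simp only [nearMax, Set.mem_ofPred_eq] at hθ
    rw [hFint] at hθ
    have hlim : Tendsto (fun j => ∫ x, ramp u hu j x ∂ν θ) atTop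
        (𝓝 (∫ x, (if 0 ≤ u x then (1 : ℝ) else 0) ∂ν θ)) := by
      refine tendsto_integral_of_dominated_convergence (fun _ => 1)
        (fun j => (BoundedContinuousFunction.integrable _ _).aestronglyMeasurable)
        (integrable_const _) (fun j => Eventually.of_forall fun x => ?_)
        (Eventually.of_forall fun x => tendsto_ramp u hu x)
      rw [Real.norm_eq_abs, abs_of_nonneg (ramp_nonneg u hu j x)]
      exact ramp_le_one u hu j x
    have hle : ∫ x, H x ∂ν θ - l * ∫ x, (if 0 ≤ u x then (1 : ℝ) else 0) ∂ν θ ≤ V := by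
      refine le_of_tendsto ((hlim.const_mul l).const_sub _) (Eventually.of_forall fun j => ?_)
      rw [← hFint]
      exact (integral_boundedContinuous_le_SE (F j) θ).trans (le_ciSup hbdd j)
    have heq : ∫ x, |(if 0 ≤ u x then (1 : ℝ) else 0) - ramp u hu k x| ∂ν θ
        = ∫ x, ramp u hu k x ∂ν θ - ∫ x, (if 0 ≤ u x then (1 : ℝ) else 0) ∂ν θ := by
      rw [← integral_sub (BoundedContinuousFunction.integrable _ _) (hint θ)]
      refine integral_congr_ae (Eventually.of_forall fun x => ?_)
      have := indicator_le_ramp u hu k x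
      simp only
      rw [abs_sub_comm, abs_of_nonneg (by linarith)]
    rw [heq]
    have := min_le_right (η / 2) (l * ε / 2)
    refine le_of_mul_le_mul_left ?_ hl0
    linarith

lemma Approximable.ite [Nonempty Θ] {a b u : E → ℝ} (hu : Continuous u) (ha : Approximable ν a)
    (hb : Approximable ν b) : Approximable ν (fun x => if 0 ≤ u x then a x else b x) := by
  have hi := approximable_indicator (ν := ν) hu
  have hn := (approximable_boundedContinuous (ν := ν) (BoundedContinuousFunction.const E 1)).add
    ((approximable_boundedContinuous (BoundedContinuousFunction.const E (-1))).mul hi)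
  convert (hi.mul ha).add (hn.mul hb) using 2 with x
  split_ifs <;> simp

end Approximation

section Recursion

variable {E Θ : Type*}

/-- The recursion defining `Srec`, started at time `j` from the value `r` and run for `k` steps. -/
noncomputable def runFrom (c : ℕ → E → ℝ) (f : ℝ → ℝ) (p q : ℝ) (n : ℕ) : ℕ → ℕ → E → ℝ → ℝ
  | 0, _, _, r => r
  | (k + 1), j, x, r =>
      runFrom c f p q n k (j + 1) x (r + (c j x - if 0 ≤ f (r / n) then p else q))

lemma runFrom_Srec (c : ℕ → E → ℝ) (f : ℝ → ℝ) (p q : ℝ) (n k j : ℕ) (x : E) :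
    runFrom c f p q n k j x (Srec c f p q n j x) = Srec c f p q n (j + k) x := by
  induction k generalizing j with
  | zero => rfl
  | succ k ih =>
    have := ih (j + 1)
    rw [show j + (k + 1) = j + 1 + k by ring, ← this]
    rfl

lemma approximable_runFrom [TopologicalSpace E] [MeasurableSpace E] [OpensMeasurableSpace E]
    [Nonempty Θ] {ν : Θ → Measure E} [∀ θ, IsProbabilityMeasure (ν θ)] {c : ℕ → E → ℝ}
    (hc : ∀ j, Continuous (c j)) {f : ℝ → ℝ} (hf : Continuous f) (p q : ℝ) (n : ℕ)
    (u : ℝ →ᵇ ℝ) (k j : ℕ) {s : E → ℝ} (hs : Continuous s) :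
    Approximable ν (fun x => u (runFrom c f p q n k j x (s x))) := by
  induction k generalizing j s with
  | zero => exact approximable_boundedContinuous (u.compContinuous ⟨s, hs⟩)
  | succ k ih =>
    have hcj := hc j
    have h1 := ih (j + 1) (s := fun x => s x + (c j x - p)) (by fun_prop)
    have h2 := ih (j + 1) (s := fun x => s x + (c j x - q)) (by fun_prop)
    have h3 : Continuous fun x => f (s x / n) := hf.comp (hs.div_const _)
    convert Approximable.ite h3 h1 h2 using 2 with x
    simp only [runFrom]
    split_ifs <;> rfl

/-- The first `i` terms of a sequence of random variables, as a random vector. -/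
def initialVec {Ω : Type*} (X : ℕ → Ω → ℝ) (i : ℕ) (ω : Ω) : Fin i → ℝ := fun j => X j ω

/-- The `j`-th coordinate of a vector, extended by zero. -/
def coordOrZero (i j : ℕ) (x : Fin i → ℝ) : ℝ := if h : j < i then x ⟨j, h⟩ else 0

lemma continuous_coordOrZero (i j : ℕ) : Continuous (coordOrZero i j) := by
  unfold coordOrZero
  split_ifs
  · fun_prop
  · fun_prop

lemma Srec_eq_coordOrZero {Ω : Type*} (X : ℕ → Ω → ℝ) (f : ℝ → ℝ) (p q : ℝ) (n i j : ℕ)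
    (hj : j ≤ i) (ω : Ω) :
    Srec X f p q n j ω = Srec (coordOrZero i) f p q n j (initialVec X i ω) := by
  induction j with
  | zero => rfl
  | succ j ih =>
    have h : coordOrZero i j (initialVec X i ω) = X j ω := by
      simp [coordOrZero, initialVec, Nat.lt_of_succ_le hj]
    simp only [Srec, h, ih (by omega)]

lemma approximable_Srec [Nonempty Θ] {i : ℕ} {ν : Θ → Measure (Fin i → ℝ)}
    [∀ θ, IsProbabilityMeasure (ν θ)] {f : ℝ → ℝ} (hf : Continuous f) (p q : ℝ) (n : ℕ)
    (u : ℝ →ᵇ ℝ) :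
    Approximable ν (fun x => u (Srec (coordOrZero i) f p q n i x)) := by
  have := approximable_runFrom (ν := ν) (continuous_coordOrZero i) hf p q n u i 0
    (s := fun _ => 0) continuous_const
  convert this using 3 with x
  have := runFrom_Srec (coordOrZero i) f p q n i 0 x
  rw [zero_add] at this
  exact this.symm

lemma measurable_Srec {f : ℝ → ℝ} (hf : Continuous f) (p q : ℝ) (n i j : ℕ) :
    Measurable (Srec (coordOrZero i) f p q n j) := by
  induction j with
  | zero => exact measurable_const
  | succ j ih =>
    refine ih.add ((continuous_coordOrZero i j).measurable.sub ?_)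
    exact Measurable.ite (measurableSet_le measurable_const
      (hf.measurable.comp (ih.div_const _))) measurable_const measurable_const

end Recursion

section Clip

/-- Truncation of a real number at levels `-R` and `R`. -/
noncomputable def clip (R y : ℝ) : ℝ := max (-R) (min R y)

lemma continuous_clip (R : ℝ) : Continuous (clip R) := by
  unfold clip; fun_prop

lemma abs_clip_le {R : ℝ} (hR : 0 ≤ R) (y : ℝ) : |clip R y| ≤ R :=
  abs_le.2 ⟨le_max_left _ _, max_le (by linarith) (min_le_left _ _)⟩

lemma clip_of_abs_le {R y : ℝ} (h : |y| ≤ R) : clip R y = y := by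
  rw [clip, min_eq_right (abs_le.1 h).2, max_eq_right (abs_le.1 h).1]

lemma abs_clip_le_abs {R : ℝ} (hR : 0 ≤ R) (y : ℝ) : |clip R y| ≤ |y| := by
  rcases le_total |y| R with h | h
  · rw [clip_of_abs_le h]
  · exact (abs_clip_le hR y).trans h

lemma clip_neg {R : ℝ} (hR : 0 ≤ R) (y : ℝ) : clip R (-y) = -clip R y := by
  simp only [clip, min_def, max_def]
  split_ifs <;> linarith

lemma clip_le_of_nonneg {R y : ℝ} (hR : 0 ≤ R) (hy : 0 ≤ y) : clip R y ≤ y :=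
  max_le (by linarith) (min_le_right _ _)

lemma abs_sub_clip_le {R : ℝ} (hR : 0 < R) (y : ℝ) : |y - clip R y| ≤ y ^ 2 / R := by
  rcases le_total |y| R with h | h
  · rw [clip_of_abs_le h, sub_self, abs_zero]; positivity
  · have h1 : |y - clip R y| ≤ |y| := by
      unfold clip
      rcases le_total 0 y with hy | hy
      · rw [abs_of_nonneg hy] at h ⊢
        rw [min_eq_left h, max_eq_right (by linarith), abs_of_nonneg (by linarith)]
        linarith
      · rw [abs_of_nonpos hy] at h ⊢
        rw [min_eq_right (by linarith), max_eq_left (by linarith), abs_of_nonpos (by linarith)]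
        linarith
    refine h1.trans ?_
    rw [le_div_iff₀ hR, ← sq_abs, sq]
    gcongr

lemma tendsto_clip (y : ℝ) : Tendsto (fun N : ℕ => clip (N + 1) y) atTop (𝓝 y) := by
  refine tendsto_const_nhds.congr' ?_
  obtain ⟨N, hN⟩ := exists_nat_ge |y|
  filter_upwards [eventually_ge_atTop N] with k hk
  have hk' : (N : ℝ) ≤ k := by exact_mod_cast hk
  exact (clip_of_abs_le (by linarith)).symm

/-- The truncation of a continuous function. -/
noncomputable def clipFun {E : Type*} [TopologicalSpace E] (k : E → ℝ) (hk : Continuous k)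
    (R : ℝ) (hR : 0 ≤ R) : E →ᵇ ℝ :=
  BoundedContinuousFunction.ofNormedAddCommGroup (fun y => clip R (k y))
    ((continuous_clip R).comp hk) R (fun _ => abs_clip_le hR _)

end Clip

section Independence

/-- A sequence that is i.i.d. under the sublinear expectation, with second moments under the
probability measures `P θ`, those of the first term being bounded by `M`. -/
structure SquareIntegrableIID {Ω Θ : Type*} [MeasurableSpace Ω] (P : Θ → Measure Ω)
    (X : ℕ → Ω → ℝ) (M : ℝ) : Prop where
  isProbabilityMeasure : ∀ θ, IsProbabilityMeasure (P θ)
  iid : SEiid P X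
  integrable : ∀ θ i, Integrable (X i) (P θ)
  integrable_sq : ∀ θ i, Integrable (fun ω => (X i ω) ^ 2) (P θ)
  integral_sq_le : ∀ θ, ∫ ω, (X 0 ω) ^ 2 ∂P θ ≤ M

variable {Ω Θ : Type*} [MeasurableSpace Ω] {P : Θ → Measure Ω} {X : ℕ → Ω → ℝ} {M : ℝ}

lemma SquareIntegrableIID.aemeasurable_initialVec (h : SquareIntegrableIID P X M) (i : ℕ)
    (θ : Θ) : AEMeasurable (initialVec X i) (P θ) :=
  aemeasurable_pi_lambda _ fun j => (h.integrable θ j).aemeasurable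

lemma SquareIntegrableIID.SE_initialVec [Nonempty Θ] (h : SquareIntegrableIID P X M) (i : ℕ)
    (φ : (Fin i → ℝ) → ℝ → ℝ) (hφ : Continuous (fun p : (Fin i → ℝ) × ℝ => φ p.1 p.2))
    (hb : ∃ C, ∀ x y, |φ x y| ≤ C) :
    SE P (fun ω => φ (initialVec X i ω) (X i ω)) =
      SE P (fun ω => SE P (fun ω' => φ (initialVec X i ω) (X 0 ω'))) := by
  have := h.isProbabilityMeasure
  cases i with
  | zero =>
    have hx : ∀ ω, initialVec X 0 ω = 0 := fun ω => Subsingleton.elim _ _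
    simp only [hx]
    simp only [SE, integral_const, probReal_univ, one_smul, ciSup_const]
  | succ i =>
    have h1 := (h.iid i).2 φ hφ hb
    refine h1.trans ?_
    congr 1
    funext ω
    obtain ⟨C, hC⟩ := hb
    exact (h.iid i).1 (φ (initialVec X (i + 1) ω))
      (hφ.comp (Continuous.prodMk_right (initialVec X (i + 1) ω))) ⟨C, hC _⟩

lemma SquareIntegrableIID.integral_mul_le_of_bounded [Nonempty Θ] (h : SquareIntegrableIID P X M)
    (i : ℕ) (θ : Θ) {D : (Fin i → ℝ) → ℝ} (hD : Measurable D) (hD0 : ∀ x, 0 ≤ D x)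
    (hDi : Integrable (fun ω => D (initialVec X i ω)) (P θ)) (k : ℝ →ᵇ ℝ) {c : ℝ}
    (hk : ∀ θ', ∫ ω, k (X 0 ω) ∂P θ' ≤ c) :
    ∫ ω, D (initialVec X i ω) * k (X i ω) ∂P θ ≤ c * ∫ ω, D (initialVec X i ω) ∂P θ := by
  have := h.isProbabilityMeasure
  have hv := h.aemeasurable_initialVec i θ
  have hXm : ∀ i θ, AEMeasurable (X i) (P θ) := fun i θ => (h.integrable θ i).aemeasurable
  have hkm : ∀ i θ, AEStronglyMeasurable (fun ω => k (X i ω)) (P θ) := fun i θ =>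
    (k.continuous.measurable.comp_aemeasurable (hXm i θ)).aestronglyMeasurable
  have hki : ∀ θ', Integrable (fun ω => k (X 0 ω)) (P θ') := fun θ' =>
    integrable_of_abs_le (hkm 0 θ') fun ω => abs_boundedContinuous_le k _
  have key : ∀ g : (Fin i → ℝ) →ᵇ ℝ,
      ∫ ω, max (g (initialVec X i ω)) 0 * (k (X i ω) - c) ∂P θ ≤ 0 := by
    intro g
    have hb : ∀ x y, |max (g x) 0 * (k y - c)| ≤ ‖g‖ * (‖k‖ + |c|) := by
      intro x y
      rw [abs_mul]
      have h1 : |max (g x) 0| ≤ ‖g‖ := by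
        rw [abs_of_nonneg (le_max_right _ _)]
        exact max_le ((le_abs_self _).trans (abs_boundedContinuous_le g x)) (norm_nonneg _)
      have h2 : |k y - c| ≤ ‖k‖ + |c| :=
        (abs_sub _ _).trans (add_le_add (abs_boundedContinuous_le k y) le_rfl)
      gcongr
    refine (integral_le_SE (P := P)
      (f := fun ω => max (g (initialVec X i ω)) 0 * (k (X i ω) - c)) (fun ω => hb _ _) θ).trans ?_
    rw [h.SE_initialVec i (fun x y => max (g x) 0 * (k y - c)) (by fun_prop) ⟨_, hb⟩]
    refine ciSup_le fun θ' => integral_nonpos fun ω => ciSup_le fun θ'' => ?_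
    rw [integral_const_mul, integral_sub (hki θ'') (integrable_const _)]
    refine mul_nonpos_of_nonneg_of_nonpos (le_max_right _ _) ?_
    simpa using hk θ''
  have hkc : ∀ ω, |k (X i ω) - c| ≤ ‖k‖ + |c| := fun ω =>
    (abs_sub _ _).trans (add_le_add (abs_boundedContinuous_le k _) le_rfl)
  have hkcm : AEStronglyMeasurable (fun ω => k (X i ω) - c) (P θ) :=
    (hkm i θ).sub aestronglyMeasurable_const
  have hDk : Integrable (fun ω => D (initialVec X i ω) * (k (X i ω) - c)) (P θ) :=
    hDi.mul_bdd hkcm (Eventually.of_forall hkc)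
  have hmain : ∫ ω, D (initialVec X i ω) * (k (X i ω) - c) ∂P θ ≤ 0 := by
    refine le_of_forall_pos_le_add fun ε hε => ?_
    have : IsProbabilityMeasure ((P θ).map (initialVec X i)) :=
      Measure.isProbabilityMeasure_map hv
    have hDν : Integrable D ((P θ).map (initialVec X i)) :=
      (integrable_map_measure hD.aestronglyMeasurable hv).2 hDi
    obtain ⟨g, hg, -⟩ := hDν.exists_boundedContinuous_integral_sub_le
      (ε := ε / (‖k‖ + |c| + 1)) (by positivity)
    have hm : AEStronglyMeasurable (fun x => ‖D x - g x‖) ((P θ).map (initialVec X i)) :=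
      (hD.aestronglyMeasurable.sub g.continuous.aestronglyMeasurable).norm
    rw [integral_map hv hm] at hg
    have hgi : Integrable (fun ω => g (initialVec X i ω)) (P θ) :=
      integrable_of_abs_le (g.continuous.measurable.comp_aemeasurable hv).aestronglyMeasurable
        fun ω => abs_boundedContinuous_le g _
    have hgp : Integrable (fun ω => max (g (initialVec X i ω)) 0) (P θ) := hgi.pos_part
    have hgk : Integrable (fun ω => max (g (initialVec X i ω)) 0 * (k (X i ω) - c)) (P θ) :=
      hgp.mul_bdd hkcm (Eventually.of_forall hkc)
    have habs : Integrable (fun ω => ‖D (initialVec X i ω) - g (initialVec X i ω)‖) (P θ) :=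
      (hDi.sub hgi).norm
    have hle : ∫ ω, D (initialVec X i ω) * (k (X i ω) - c) ∂P θ
        ≤ ∫ ω, (max (g (initialVec X i ω)) 0 * (k (X i ω) - c)
          + (‖k‖ + |c| + 1) * ‖D (initialVec X i ω) - g (initialVec X i ω)‖) ∂P θ := by
      refine integral_mono hDk (hgk.add (habs.const_mul _)) fun ω => ?_
      simp only
      set d := D (initialVec X i ω) with hd
      set e := g (initialVec X i ω)
      have h0 : 0 ≤ d := hD0 _
      have h1 : |d - max e 0| ≤ |d - e| := by
        have := abs_max_sub_max_le_abs d e 0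
        rwa [max_eq_left h0] at this
      have h2 : (d - max e 0) * (k (X i ω) - c) ≤ |d - e| * (‖k‖ + |c| + 1) := by
        refine (le_abs_self _).trans ?_
        rw [abs_mul]
        have := hkc ω
        gcongr
        linarith
      rw [Real.norm_eq_abs]
      linarith
    rw [integral_add hgk (habs.const_mul _), integral_const_mul] at hle
    have : (‖k‖ + |c| + 1) * ∫ ω, ‖D (initialVec X i ω) - g (initialVec X i ω)‖ ∂P θ ≤ ε := by
      have hpos : 0 < ‖k‖ + |c| + 1 := by positivity
      have := mul_le_mul_of_nonneg_left hg hpos.le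
      rwa [mul_div_cancel₀ _ hpos.ne'] at this
    linarith [key g]
  have hDk' : Integrable (fun ω => D (initialVec X i ω) * k (X i ω)) (P θ) :=
    hDi.mul_bdd (hkm i θ) (Eventually.of_forall fun ω => abs_boundedContinuous_le k _)
  have heq : ∫ ω, D (initialVec X i ω) * (k (X i ω) - c) ∂P θ
      = ∫ ω, D (initialVec X i ω) * k (X i ω) ∂P θ - c * ∫ ω, D (initialVec X i ω) ∂P θ := by
    rw [← integral_const_mul, ← integral_sub hDk' (hDi.const_mul c)]
    congr 1
    funext ω
    ring
  linarith

/-- Under every `P θ`, the conditional expectation of `k (X i)` given the past is bounded by any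
upper bound of the expectations of `k (X 0)`. -/
lemma SquareIntegrableIID.integral_mul_le [Nonempty Θ] (h : SquareIntegrableIID P X M)
    (i : ℕ) (θ : Θ) {D : (Fin i → ℝ) → ℝ} (hD : Measurable D) (hD0 : ∀ x, 0 ≤ D x)
    (hDi : Integrable (fun ω => D (initialVec X i ω)) (P θ)) {k : ℝ → ℝ} (hkc : Continuous k)
    (hDk : Integrable (fun ω => D (initialVec X i ω) * k (X i ω)) (P θ)) {c B : ℝ}
    (hk : ∀ R, 0 < R → ∀ θ', ∫ ω, clip R (k (X 0 ω)) ∂P θ' ≤ c + B / R) :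
    ∫ ω, D (initialVec X i ω) * k (X i ω) ∂P θ ≤ c * ∫ ω, D (initialVec X i ω) ∂P θ := by
  have hbd : ∀ N : ℕ, ∫ ω, D (initialVec X i ω) * clip (N + 1) (k (X i ω)) ∂P θ
      ≤ (c + B / (N + 1)) * ∫ ω, D (initialVec X i ω) ∂P θ := fun N =>
    h.integral_mul_le_of_bounded i θ hD hD0 hDi (clipFun k hkc (N + 1) (by positivity))
      (hk _ (by positivity))
  have hlim : Tendsto (fun N : ℕ => ∫ ω, D (initialVec X i ω) * clip (N + 1) (k (X i ω)) ∂P θ)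
      atTop (𝓝 (∫ ω, D (initialVec X i ω) * k (X i ω) ∂P θ)) := by
    refine tendsto_integral_of_dominated_convergence
      (fun ω => ‖D (initialVec X i ω) * k (X i ω)‖) (fun N => ?_) hDk.norm
      (fun N => Eventually.of_forall fun ω => ?_)
      (Eventually.of_forall fun ω => (tendsto_clip _).const_mul _)
    · exact hDi.aestronglyMeasurable.mul (((continuous_clip _).comp hkc).measurable.comp_aemeasurable
        (h.integrable θ i).aemeasurable).aestronglyMeasurable
    · rw [norm_mul, norm_mul]
      exact mul_le_mul_of_nonneg_left (abs_clip_le_abs (by positivity) _) (norm_nonneg _)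
  have hlim2 : Tendsto (fun N : ℕ => (c + B / ((N : ℝ) + 1)) * ∫ ω, D (initialVec X i ω) ∂P θ)
      atTop (𝓝 ((c + 0) * ∫ ω, D (initialVec X i ω) ∂P θ)) := by
    refine Tendsto.mul_const _ (tendsto_const_nhds.add ?_)
    have := (tendsto_one_div_add_atTop_nhds_zero_nat (𝕜 := ℝ)).const_mul B
    simpa [div_eq_mul_inv] using this
  rw [add_zero] at hlim2
  exact le_of_tendsto_of_tendsto' hlim hlim2 hbd

end Independence

section Drift

/-- The largest value of `a * m` for `m` in the interval `[q, p]`. -/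
noncomputable def maxDrift (p q a : ℝ) : ℝ := max a 0 * p - max (-a) 0 * q

lemma maxDrift_of_nonneg {p q a : ℝ} (ha : 0 ≤ a) : maxDrift p q a = a * p := by
  simp [maxDrift, ha]

lemma maxDrift_of_nonpos {p q a : ℝ} (ha : a ≤ 0) : maxDrift p q a = a * q := by
  simp [maxDrift, ha]

lemma maxDrift_eq_ite (p q a : ℝ) : maxDrift p q a = a * if 0 ≤ a then p else q := by
  split_ifs with h
  · exact maxDrift_of_nonneg h
  · exact maxDrift_of_nonpos (not_le.1 h).le

lemma continuous_maxDrift (p q : ℝ) : Continuous (maxDrift p q) := by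
  unfold maxDrift; fun_prop

lemma abs_maxDrift_sub_le (p q a b : ℝ) :
    |maxDrift p q a - maxDrift p q b| ≤ (|p| + |q|) * |a - b| := by
  have h1 : |max a 0 - max b 0| ≤ |a - b| := abs_max_sub_max_le_abs a b 0
  have h2 : |max (-a) 0 - max (-b) 0| ≤ |a - b| := by
    have := abs_max_sub_max_le_abs (-a) (-b) 0
    rwa [neg_sub_neg, abs_sub_comm b a] at this
  have : maxDrift p q a - maxDrift p q b
      = (max a 0 - max b 0) * p - (max (-a) 0 - max (-b) 0) * q := by
    unfold maxDrift; ring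
  rw [this]
  refine (abs_sub _ _).trans ?_
  rw [abs_mul, abs_mul]
  nlinarith [abs_nonneg p, abs_nonneg q, mul_le_mul_of_nonneg_right h1 (abs_nonneg p),
    mul_le_mul_of_nonneg_right h2 (abs_nonneg q)]

lemma abs_maxDrift_sub_le' {p q p' q' δ : ℝ} (hp : |p - p'| ≤ δ) (hq : |q - q'| ≤ δ) (a : ℝ) :
    |maxDrift p q a - maxDrift p' q' a| ≤ δ * |a| := by
  rw [maxDrift_eq_ite, maxDrift_eq_ite]
  split_ifs
  · rw [← mul_sub, abs_mul, mul_comm]; gcongr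
  · rw [← mul_sub, abs_mul, mul_comm]; gcongr

lemma abs_maxDrift_le (p q a : ℝ) : |maxDrift p q a| ≤ (|p| + |q|) * |a| := by
  have := abs_maxDrift_sub_le p q a 0
  simpa [maxDrift] using this

lemma SE_add_mul_sub_maxDrift {Ω Θ : Type*} [MeasurableSpace Ω] [Nonempty Θ]
    {P : Θ → Measure Ω} [∀ θ, IsProbabilityMeasure (P θ)] {W : Ω → ℝ} {C : ℝ}
    (hW : ∀ θ, Integrable W (P θ)) (hC : ∀ ω, |W ω| ≤ C) (b a : ℝ) :
    SE P (fun ω => b + (a * W ω - maxDrift (SE P W) (-SE P (fun ω => -W ω)) a)) = b := by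
  have hint : ∀ θ, ∫ ω, (b + (a * W ω - maxDrift (SE P W) (-SE P (fun ω => -W ω)) a)) ∂P θ
      = b + (a * ∫ ω, W ω ∂P θ - maxDrift (SE P W) (-SE P (fun ω => -W ω)) a) := by
    intro θ
    have hs : Integrable
        (fun ω => a * W ω - maxDrift (SE P W) (-SE P (fun ω => -W ω)) a) (P θ) :=
      ((hW θ).const_mul a).sub (integrable_const _)
    rw [integral_add (integrable_const _) hs,
      integral_sub ((hW θ).const_mul a) (integrable_const _), integral_const_mul]
    simp
  have hle : ∀ θ, ∫ ω, W ω ∂P θ ≤ SE P W := integral_le_SE hC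
  have hge : ∀ θ, -∫ ω, W ω ∂P θ ≤ SE P (fun ω => -W ω) := fun θ => by
    rw [← integral_neg]
    exact integral_le_SE (P := P) (f := fun ω => -W ω) (C := C) (fun ω => by simpa using hC ω) θ
  have hup : ∀ θ, b + (a * ∫ ω, W ω ∂P θ - maxDrift (SE P W) (-SE P (fun ω => -W ω)) a) ≤ b := by
    intro θ
    rcases le_total 0 a with ha | ha
    · rw [maxDrift_of_nonneg ha]
      nlinarith [hle θ]
    · rw [maxDrift_of_nonpos ha]
      nlinarith [hge θ]
  refine le_antisymm (ciSup_le fun θ => (hint θ).trans_le (hup θ)) ?_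
  set s := SE P (fun ω => b + (a * W ω - maxDrift (SE P W) (-SE P (fun ω => -W ω)) a)) with hs
  have hsup : ∀ θ, b + (a * ∫ ω, W ω ∂P θ - maxDrift (SE P W) (-SE P (fun ω => -W ω)) a) ≤ s := by
    intro θ
    rw [← hint]
    refine le_ciSup (f := fun θ => ∫ ω,
      (b + (a * W ω - maxDrift (SE P W) (-SE P (fun ω => -W ω)) a)) ∂P θ) ⟨b, ?_⟩ θ
    rintro _ ⟨θ, rfl⟩
    exact (hint θ).trans_le (hup θ)
  rcases lt_trichotomy a 0 with ha | ha | ha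
  · rw [maxDrift_of_nonpos ha.le] at hsup
    have : SE P (fun ω => -W ω) ≤ SE P (fun ω => -W ω) + (s - b) / (-a) := by
      conv_lhs => unfold SE
      refine ciSup_le fun θ => ?_
      rw [integral_neg, ← sub_le_iff_le_add', le_div_iff₀ (by linarith)]
      linarith [hsup θ]
    have h0 : 0 ≤ (s - b) / (-a) := by linarith
    have := mul_nonneg h0 (neg_nonneg.2 ha.le)
    rw [div_mul_cancel₀ _ (by linarith)] at this
    linarith
  · obtain ⟨θ⟩ := ‹Nonempty Θ›
    have := hsup θ
    rw [ha, maxDrift_of_nonneg le_rfl] at this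
    linarith
  · rw [maxDrift_of_nonneg ha.le] at hsup
    have : SE P W ≤ SE P W + (s - b) / a := by
      conv_lhs => unfold SE
      refine ciSup_le fun θ => ?_
      rw [← sub_le_iff_le_add', le_div_iff₀ ha]
      linarith [hsup θ]
    have h0 : 0 ≤ (s - b) / a := by linarith
    have := mul_nonneg h0 ha.le
    rw [div_mul_cancel₀ _ ha.ne'] at this
    linarith

lemma abs_SE_sub_le {Ω Θ : Type*} [MeasurableSpace Ω] [Nonempty Θ] {P : Θ → Measure Ω}
    {U V : Ω → ℝ} {δ : ℝ} (hU : BddAbove (Set.range fun θ => ∫ ω, U ω ∂P θ))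
    (hV : BddAbove (Set.range fun θ => ∫ ω, V ω ∂P θ))
    (h : ∀ θ, |∫ ω, U ω ∂P θ - ∫ ω, V ω ∂P θ| ≤ δ) : |SE P U - SE P V| ≤ δ := by
  rw [abs_le]
  constructor
  · have : SE P V ≤ SE P U + δ := ciSup_le fun θ => by
      have h1 : ∫ ω, U ω ∂P θ ≤ SE P U := le_ciSup hU θ
      linarith [(abs_le.1 (h θ)).1]
    linarith
  · have : SE P U ≤ SE P V + δ := ciSup_le fun θ => by
      have h1 : ∫ ω, V ω ∂P θ ≤ SE P V := le_ciSup hV θ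
      linarith [(abs_le.1 (h θ)).2]
    linarith

end Drift

section Moments

variable {Ω Θ : Type*} [MeasurableSpace Ω] {P : Θ → Measure Ω} {X : ℕ → Ω → ℝ} {M : ℝ}

lemma SquareIntegrableIID.integrable_clip (h : SquareIntegrableIID P X M) (i : ℕ) (θ : Θ) {R : ℝ}
    (hR : 0 ≤ R) : Integrable (fun ω => clip R (X i ω)) (P θ) := by
  have := h.isProbabilityMeasure
  exact integrable_of_abs_le ((continuous_clip R).measurable.comp_aemeasurable
    (h.integrable θ i).aemeasurable).aestronglyMeasurable fun ω => abs_clip_le hR _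

lemma SquareIntegrableIID.abs_integral_sub_clip_le (h : SquareIntegrableIID P X M) (θ : Θ) {R : ℝ}
    (hR : 0 < R) : |∫ ω, X 0 ω ∂P θ - ∫ ω, clip R (X 0 ω) ∂P θ| ≤ M / R := by
  rw [← integral_sub (h.integrable θ 0) (h.integrable_clip 0 θ hR.le)]
  calc |∫ ω, (X 0 ω - clip R (X 0 ω)) ∂P θ| ≤ ∫ ω, |X 0 ω - clip R (X 0 ω)| ∂P θ :=
        abs_integral_le_integral_abs
    _ ≤ ∫ ω, (X 0 ω) ^ 2 / R ∂P θ :=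
        integral_mono (((h.integrable θ 0).sub (h.integrable_clip 0 θ hR.le)).abs)
          ((h.integrable_sq θ 0).div_const R) fun ω => abs_sub_clip_le hR _
    _ ≤ M / R := by
        rw [integral_div]
        gcongr
        exact h.integral_sq_le θ

lemma SquareIntegrableIID.integral_mul_le_of_nonneg [Nonempty Θ] (h : SquareIntegrableIID P X M)
    (i : ℕ) (θ : Θ) {D : (Fin i → ℝ) → ℝ} (hD : Measurable D) (hD0 : ∀ x, 0 ≤ D x)
    (hDi : Integrable (fun ω => D (initialVec X i ω)) (P θ)) {k : ℝ → ℝ} (hkc : Continuous k)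
    (hk0 : ∀ y, 0 ≤ k y)
    (hDk : Integrable (fun ω => D (initialVec X i ω) * k (X i ω)) (P θ)) {c : ℝ}
    (hki : ∀ θ', Integrable (fun ω => k (X 0 ω)) (P θ'))
    (hk : ∀ θ', ∫ ω, k (X 0 ω) ∂P θ' ≤ c) :
    ∫ ω, D (initialVec X i ω) * k (X i ω) ∂P θ ≤ c * ∫ ω, D (initialVec X i ω) ∂P θ := by
  have := h.isProbabilityMeasure
  refine h.integral_mul_le i θ hD hD0 hDi hkc hDk (B := 0) fun R hR θ' => ?_
  rw [zero_div, add_zero]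
  refine le_trans (integral_mono ?_ (hki θ') fun ω => clip_le_of_nonneg hR.le (hk0 _)) (hk θ')
  exact integrable_of_abs_le ((continuous_clip R).comp_aestronglyMeasurable
    (hki θ').aestronglyMeasurable) fun ω => abs_clip_le hR.le _

lemma SquareIntegrableIID.integral_abs_le (h : SquareIntegrableIID P X M) (θ : Θ) :
    ∫ ω, |X 0 ω| ∂P θ ≤ 1 + M := by
  have := h.isProbabilityMeasure
  calc ∫ ω, |X 0 ω| ∂P θ ≤ ∫ ω, (1 + (X 0 ω) ^ 2) ∂P θ :=
        integral_mono (h.integrable θ 0).abs ((integrable_const _).add (h.integrable_sq θ 0))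
          fun ω => by
            simp only
            nlinarith [sq_nonneg (|X 0 ω| - 1), sq_abs (X 0 ω), abs_nonneg (X 0 ω)]
    _ ≤ 1 + M := by
        rw [integral_add (integrable_const _) (h.integrable_sq θ 0)]
        simpa using h.integral_sq_le θ

lemma SquareIntegrableIID.integral_mul_abs_le [Nonempty Θ] (h : SquareIntegrableIID P X M)
    (i : ℕ) (θ : Θ) {D : (Fin i → ℝ) → ℝ} (hD : Measurable D) (hD0 : ∀ x, 0 ≤ D x)
    (hDi : Integrable (fun ω => D (initialVec X i ω)) (P θ))
    (hDX : Integrable (fun ω => D (initialVec X i ω) * |X i ω|) (P θ)) :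
    ∫ ω, D (initialVec X i ω) * |X i ω| ∂P θ ≤ (1 + M) * ∫ ω, D (initialVec X i ω) ∂P θ :=
  h.integral_mul_le_of_nonneg i θ hD hD0 hDi continuous_abs abs_nonneg hDX
    (fun θ' => (h.integrable θ' 0).abs) h.integral_abs_le

lemma SquareIntegrableIID.integral_sq_le' [Nonempty Θ] (h : SquareIntegrableIID P X M)
    (i : ℕ) (θ : Θ) :
    ∫ ω, (X i ω) ^ 2 ∂P θ ≤ M := by
  have := h.isProbabilityMeasure
  have := h.integral_mul_le_of_nonneg i θ (D := fun _ => 1) measurable_const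
    (fun _ => zero_le_one) (integrable_const _) (k := fun y => y ^ 2) (by fun_prop)
    (fun y => sq_nonneg y) (by simpa using h.integrable_sq θ i)
    (fun θ' => h.integrable_sq θ' 0) h.integral_sq_le
  simpa using this

lemma SquareIntegrableIID.integral_mul_le_integral_maxDrift [Nonempty Θ]
    (h : SquareIntegrableIID P X M)
    {p q : ℝ} (hp : ∀ θ, ∫ ω, X 0 ω ∂P θ ≤ p) (hq : ∀ θ, q ≤ ∫ ω, X 0 ω ∂P θ)
    (i : ℕ) (θ : Θ) {A : (Fin i → ℝ) → ℝ} (hA : Measurable A)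
    (hAi : Integrable (fun ω => A (initialVec X i ω)) (P θ))
    (hAX : Integrable (fun ω => A (initialVec X i ω) * X i ω) (P θ)) :
    ∫ ω, A (initialVec X i ω) * X i ω ∂P θ
      ≤ ∫ ω, maxDrift p q (A (initialVec X i ω)) ∂P θ := by
  have hXm := (h.integrable θ i).aestronglyMeasurable
  have hDi1 : Integrable (fun ω => max (A (initialVec X i ω)) 0) (P θ) := hAi.pos_part
  have hDi2 : Integrable (fun ω => max (-A (initialVec X i ω)) 0) (P θ) := hAi.neg_part
  have hDX1 : Integrable (fun ω => max (A (initialVec X i ω)) 0 * X i ω) (P θ) := by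
    refine hAX.mono (hDi1.aestronglyMeasurable.mul hXm) (Eventually.of_forall fun ω => ?_)
    rw [norm_mul, norm_mul, Real.norm_eq_abs, Real.norm_eq_abs (A _),
      abs_of_nonneg (le_max_right _ _)]
    gcongr
    exact max_le (le_abs_self _) (abs_nonneg _)
  have hDX2 : Integrable (fun ω => max (-A (initialVec X i ω)) 0 * -X i ω) (P θ) := by
    refine hAX.mono (hDi2.aestronglyMeasurable.mul hXm.neg) (Eventually.of_forall fun ω => ?_)
    rw [norm_mul, norm_mul, norm_neg, Real.norm_eq_abs, Real.norm_eq_abs (A _),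
      abs_of_nonneg (le_max_right _ _)]
    gcongr
    exact max_le (neg_le_abs _) (abs_nonneg _)
  have h1 := h.integral_mul_le i θ (D := fun x => max (A x) 0) (hA.max measurable_const)
    (fun _ => le_max_right _ _) hDi1 (k := fun y => y) continuous_id hDX1 (c := p) (B := M)
    fun R hR θ' => by
      linarith [(abs_le.1 (h.abs_integral_sub_clip_le θ' hR)).1, hp θ']
  have h2 := h.integral_mul_le i θ (D := fun x => max (-A x) 0) (hA.neg.max measurable_const)
    (fun _ => le_max_right _ _) hDi2 (k := fun y => -y) continuous_neg hDX2 (c := -q) (B := M)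
    fun R hR θ' => by
      simp only [clip_neg hR.le]
      rw [integral_neg]
      linarith [(abs_le.1 (h.abs_integral_sub_clip_le θ' hR)).2, hq θ']
  have e1 : ∫ ω, A (initialVec X i ω) * X i ω ∂P θ
      = ∫ ω, max (A (initialVec X i ω)) 0 * X i ω ∂P θ
        + ∫ ω, max (-A (initialVec X i ω)) 0 * -X i ω ∂P θ := by
    rw [← integral_add hDX1 hDX2]
    congr 1
    funext ω
    rcases le_total 0 (A (initialVec X i ω)) with ha | ha <;> simp [ha]
  have e2 : ∫ ω, maxDrift p q (A (initialVec X i ω)) ∂P θ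
      = p * ∫ ω, max (A (initialVec X i ω)) 0 ∂P θ
        + -q * ∫ ω, max (-A (initialVec X i ω)) 0 ∂P θ := by
    rw [← integral_const_mul, ← integral_const_mul,
      ← integral_add (hDi1.const_mul _) (hDi2.const_mul _)]
    congr 1
    funext ω
    unfold maxDrift
    ring
  rw [e1, e2]
  exact add_le_add h1 h2

end Moments

section Taylor

lemma abs_sub_sub_deriv_mul_le {φ : ℝ → ℝ} (hφ : Differentiable ℝ φ) {L : NNReal}
    (hL : LipschitzWith L (deriv φ)) (x y : ℝ) :
    |φ y - φ x - deriv φ x * (y - x)| ≤ L / 2 * (y - x) ^ 2 := by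
  have hg : ∀ t : ℝ, HasDerivAt (fun t => φ (x + t * (y - x)) - φ x - deriv φ x * (t * (y - x)))
      ((deriv φ (x + t * (y - x)) - deriv φ x) * (y - x)) t := by
    intro t
    have h1 : HasDerivAt (fun t : ℝ => x + t * (y - x)) (y - x) t := by
      simpa using ((hasDerivAt_id t).mul_const (y - x)).const_add x
    have h2 : HasDerivAt (fun t : ℝ => deriv φ x * (t * (y - x))) (deriv φ x * (y - x)) t := by
      simpa using ((hasDerivAt_id t).mul_const (y - x)).const_mul (deriv φ x)
    have h3 := (((hφ _).hasDerivAt.comp t h1).sub_const (φ x)).sub h2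
    rw [← sub_mul] at h3
    exact h3
  have hB : ∀ t : ℝ, HasDerivAt (fun t : ℝ => L / 2 * (y - x) ^ 2 * t ^ 2)
      (L * (y - x) ^ 2 * t) t := by
    intro t
    have := ((hasDerivAt_id t).pow 2).const_mul ((L : ℝ) / 2 * (y - x) ^ 2)
    refine this.congr_deriv ?_
    simp only [id]
    push_cast
    ring
  have := image_norm_le_of_norm_deriv_right_le_deriv_boundary (a := 0) (b := 1)
    (f := fun t => φ (x + t * (y - x)) - φ x - deriv φ x * (t * (y - x)))
    (fun t _ => (hg t).continuousAt.continuousWithinAt) (fun t _ => (hg t).hasDerivWithinAt)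
    (B := fun t : ℝ => L / 2 * (y - x) ^ 2 * t ^ 2) (by simp) hB (fun t ht => by
      rw [norm_mul, Real.norm_eq_abs (y - x)]
      have h := hL.norm_sub_le (x + t * (y - x)) x
      rw [add_sub_cancel_left, norm_mul, Real.norm_eq_abs (y - x), Real.norm_eq_abs t,
        abs_of_nonneg ht.1] at h
      calc _ ≤ L * (t * |y - x|) * |y - x| := by gcongr
        _ = L * (y - x) ^ 2 * t := by rw [← sq_abs]; ring)
    (Set.right_mem_Icc.2 zero_le_one)
  simpa using this

end Taylor

section PartialSums

variable {Ω Θ : Type*} [MeasurableSpace Ω] {P : Θ → Measure Ω} {X : ℕ → Ω → ℝ} {M : ℝ}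
  {f : ℝ → ℝ} {L : NNReal}

lemma abs_ite_le (s : Prop) [Decidable s] (p q : ℝ) : |if s then p else q| ≤ |p| + |q| := by
  split_ifs
  · exact le_add_of_nonneg_right (abs_nonneg _)
  · exact le_add_of_nonneg_left (abs_nonneg _)

lemma abs_le_of_lipschitzWith (hf : LipschitzWith L f) (y : ℝ) : |f y| ≤ |f 0| + L * |y| := by
  have h := hf.norm_sub_le y 0
  rw [sub_zero, Real.norm_eq_abs, Real.norm_eq_abs] at h
  linarith [abs_sub_abs_le_abs_sub (f y) (f 0)]

/-- The value of `f` at the normalised partial sum, as a function of the first `i` terms. -/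
noncomputable def slopeOfVec (f : ℝ → ℝ) (p q : ℝ) (n i : ℕ) (x : Fin i → ℝ) : ℝ :=
  f (Srec (coordOrZero i) f p q n i x / n)

lemma slopeOfVec_initialVec {Ω : Type*} (X : ℕ → Ω → ℝ) (f : ℝ → ℝ) (p q : ℝ) (n i : ℕ) (ω : Ω) :
    slopeOfVec f p q n i (initialVec X i ω) = f (Srec X f p q n i ω / n) := by
  rw [slopeOfVec, Srec_eq_coordOrZero X f p q n i i le_rfl ω]

lemma measurable_slopeOfVec (hf : Continuous f) (p q : ℝ) (n i : ℕ) :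
    Measurable (slopeOfVec f p q n i) :=
  hf.measurable.comp ((measurable_Srec hf p q n i i).div_const _)

lemma SquareIntegrableIID.memLp_two (h : SquareIntegrableIID P X M) (i : ℕ) (θ : Θ) :
    MemLp (X i) 2 (P θ) :=
  (memLp_two_iff_integrable_sq (h.integrable θ i).aestronglyMeasurable).2 (h.integrable_sq θ i)

lemma memLp_two_comp_div {P : Measure Ω} [IsFiniteMeasure P] (hf : LipschitzWith L f) {s : Ω → ℝ}
    (hs : MemLp s 2 P) (r : ℝ) : MemLp (fun ω => f (s ω / r)) 2 P := by
  have hd : MemLp (fun ω => s ω / r) 2 P := by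
    simpa only [div_eq_mul_inv] using hs.mul_const r⁻¹
  have hb : MemLp (fun ω => |f 0| + L * |s ω / r|) 2 P :=
    (memLp_const |f 0|).add (hd.abs.const_mul (L : ℝ))
  refine hb.of_le (hf.continuous.comp_aestronglyMeasurable hd.aestronglyMeasurable)
    (Eventually.of_forall fun ω => ?_)
  rw [Real.norm_eq_abs, Real.norm_eq_abs]
  exact (abs_le_of_lipschitzWith hf (s ω / r)).trans (le_abs_self _)

lemma SquareIntegrableIID.memLp_two_centering (h : SquareIntegrableIID P X M)
    (hf : Continuous f) (p q : ℝ) (n i : ℕ) (θ : Θ) :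
    MemLp (fun ω => if 0 ≤ f (Srec X f p q n i ω / n) then p else q) 2 (P θ) := by
  have := h.isProbabilityMeasure
  refine MemLp.of_bound (C := |p| + |q|) ?_ (Eventually.of_forall fun ω => abs_ite_le _ p q)
  have hm : Measurable fun x => if 0 ≤ slopeOfVec f p q n i x then p else q :=
    Measurable.ite (measurableSet_le measurable_const (measurable_slopeOfVec hf p q n i))
      measurable_const measurable_const
  have := (hm.comp_aemeasurable (h.aemeasurable_initialVec i θ)).aestronglyMeasurable
  refine this.congr (Eventually.of_forall fun ω => ?_)
  simp only [Function.comp_apply, slopeOfVec_initialVec]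

lemma SquareIntegrableIID.memLp_two_Srec (h : SquareIntegrableIID P X M)
    (hf : Continuous f) (p q : ℝ) (n i : ℕ) (θ : Θ) :
    MemLp (Srec X f p q n i) 2 (P θ) := by
  induction i with
  | zero => exact MemLp.zero
  | succ i ih => exact ih.add ((h.memLp_two i θ).sub (h.memLp_two_centering hf p q n i θ))

lemma SquareIntegrableIID.memLp_two_slope (h : SquareIntegrableIID P X M)
    (hf : LipschitzWith L f) (p q : ℝ) (n i : ℕ) (θ : Θ) :
    MemLp (fun ω => f (Srec X f p q n i ω / n)) 2 (P θ) := by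
  have := h.isProbabilityMeasure
  exact memLp_two_comp_div hf (h.memLp_two_Srec hf.continuous p q n i θ) n

lemma SquareIntegrableIID.exists_integral_Srec_sq_le [Nonempty Θ]
    (h : SquareIntegrableIID P X M) (hf : Continuous f) (p q : ℝ) (n i : ℕ) :
    ∃ K, ∀ θ, ∫ ω, (Srec X f p q n i ω) ^ 2 ∂P θ ≤ K := by
  have := h.isProbabilityMeasure
  induction i with
  | zero => exact ⟨0, fun θ => by simp [Srec]⟩
  | succ i ih =>
    obtain ⟨K, hK⟩ := ih
    refine ⟨3 * K + 3 * M + 3 * (|p| + |q|) ^ 2, fun θ => ?_⟩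
    have h1 := (h.memLp_two_Srec hf p q n i θ).integrable_sq.const_mul 3
    have h2 := (h.integrable_sq θ i).const_mul 3
    have h3 : Integrable (fun ω => 3 * (Srec X f p q n i ω) ^ 2 + 3 * (X i ω) ^ 2) (P θ) :=
      h1.add h2
    calc ∫ ω, (Srec X f p q n (i + 1) ω) ^ 2 ∂P θ
        ≤ ∫ ω, (3 * (Srec X f p q n i ω) ^ 2 + 3 * (X i ω) ^ 2 + 3 * (|p| + |q|) ^ 2) ∂P θ := by
          refine integral_mono (h.memLp_two_Srec hf p q n (i + 1) θ).integrable_sq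
            (h3.add (integrable_const _)) fun ω => ?_
          simp only [Srec]
          have hm := abs_ite_le (0 ≤ f (Srec X f p q n i ω / n)) p q
          set m := if 0 ≤ f (Srec X f p q n i ω / n) then p else q
          set s := Srec X f p q n i ω
          have : m ^ 2 ≤ (|p| + |q|) ^ 2 := sq_le_sq' (abs_le.1 hm).1 (abs_le.1 hm).2
          nlinarith [sq_nonneg (s - X i ω), sq_nonneg (s + m), sq_nonneg (X i ω + m)]
      _ ≤ _ := by
          rw [integral_add h3 (integrable_const _), integral_add h1 h2,
            integral_const_mul, integral_const_mul]
          simp only [integral_const, probReal_univ, one_smul]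
          linarith [hK θ, h.integral_sq_le' i θ]

lemma SquareIntegrableIID.exists_integral_slope_sq_le [Nonempty Θ]
    (h : SquareIntegrableIID P X M) (hf : LipschitzWith L f) (p q : ℝ) (n i : ℕ) :
    ∃ K, ∀ θ, ∫ ω, (f (Srec X f p q n i ω / n)) ^ 2 ∂P θ ≤ K := by
  have := h.isProbabilityMeasure
  obtain ⟨K, hK⟩ := h.exists_integral_Srec_sq_le hf.continuous p q n i
  refine ⟨2 * |f 0| ^ 2 + 2 * L ^ 2 / n ^ 2 * K, fun θ => ?_⟩
  have h1 := (h.memLp_two_Srec hf.continuous p q n i θ).integrable_sq.const_mul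
    (2 * (L : ℝ) ^ 2 / n ^ 2)
  calc ∫ ω, (f (Srec X f p q n i ω / n)) ^ 2 ∂P θ
      ≤ ∫ ω, (2 * |f 0| ^ 2 + 2 * L ^ 2 / n ^ 2 * (Srec X f p q n i ω) ^ 2) ∂P θ := by
        refine integral_mono (h.memLp_two_slope hf p q n i θ).integrable_sq
          ((integrable_const _).add h1) fun ω => ?_
        simp only
        set s := Srec X f p q n i ω
        have hb := abs_le_of_lipschitzWith hf (s / n)
        have e : 2 * (L : ℝ) ^ 2 / n ^ 2 * s ^ 2 = 2 * (L * |s / n|) ^ 2 := by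
          rw [mul_pow, sq_abs, div_pow]; ring
        rw [e, ← sq_abs (f (s / n))]
        nlinarith [sq_nonneg (|f 0| - L * |s / n|), abs_nonneg (f (s / n))]
    _ ≤ _ := by
        rw [integral_add (integrable_const _) h1, integral_const_mul (2 * (L : ℝ) ^ 2 / n ^ 2)]
        simp only [integral_const, probReal_univ, one_smul]
        have h2 : (0 : ℝ) ≤ 2 * (L : ℝ) ^ 2 / n ^ 2 := by positivity
        exact add_le_add le_rfl (mul_le_mul_of_nonneg_left (hK θ) h2)

lemma SquareIntegrableIID.integral_sub_centering_sq_le [Nonempty Θ]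
    (h : SquareIntegrableIID P X M) (hf : Continuous f) (p q : ℝ) (n i : ℕ) (θ : Θ) {c : ℝ}
    (hp : ∀ θ, ∫ ω, (X 0 ω - p) ^ 2 ∂P θ ≤ c) (hq : ∀ θ, ∫ ω, (X 0 ω - q) ^ 2 ∂P θ ≤ c) :
    ∫ ω, (X i ω - if 0 ≤ f (Srec X f p q n i ω / n) then p else q) ^ 2 ∂P θ ≤ c := by
  have := h.isProbabilityMeasure
  have hsq : ∀ r i θ, Integrable (fun ω => (X i ω - r) ^ 2) (P θ) := fun r i θ =>
    ((h.memLp_two i θ).sub (memLp_const r)).integrable_sq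
  have hms : MeasurableSet {x | 0 ≤ slopeOfVec f p q n i x} :=
    measurableSet_le measurable_const (measurable_slopeOfVec hf p q n i)
  have key : ∀ s : Set (Fin i → ℝ), MeasurableSet s → ∀ r, (∀ θ, ∫ ω, (X 0 ω - r) ^ 2 ∂P θ ≤ c) →
      Integrable (fun ω => s.indicator (fun _ => (1 : ℝ)) (initialVec X i ω)) (P θ) ∧
      Integrable (fun ω => s.indicator (fun _ => (1 : ℝ)) (initialVec X i ω) * (X i ω - r) ^ 2)
        (P θ) ∧
      ∫ ω, s.indicator (fun _ => (1 : ℝ)) (initialVec X i ω) * (X i ω - r) ^ 2 ∂P θ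
        ≤ c * ∫ ω, s.indicator (fun _ => (1 : ℝ)) (initialVec X i ω) ∂P θ := by
    intro s hs r hr
    have hm : Measurable (s.indicator fun _ => (1 : ℝ)) := measurable_const.indicator hs
    have hma := (hm.comp_aemeasurable (h.aemeasurable_initialVec i θ)).aestronglyMeasurable
    have hb : ∀ x, |s.indicator (fun _ => (1 : ℝ)) x| ≤ 1 := fun x => by
      unfold Set.indicator; split_ifs <;> simp
    have h1 : Integrable (fun ω => s.indicator (fun _ => (1 : ℝ)) (initialVec X i ω)) (P θ) :=
      integrable_of_abs_le hma fun ω => hb _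
    have h2 := (hsq r i θ).bdd_mul hma (Eventually.of_forall fun ω => hb _)
    refine ⟨h1, h2, ?_⟩
    exact h.integral_mul_le_of_nonneg i θ hm (Set.indicator_nonneg fun _ _ => zero_le_one) h1
      (k := fun y => (y - r) ^ 2) (by fun_prop) (fun y => sq_nonneg _) h2
      (fun θ' => hsq r 0 θ') hr
  obtain ⟨a1, a2, a3⟩ := key _ hms p hp
  obtain ⟨b1, b2, b3⟩ := key _ hms.compl q hq
  have e : ∀ ω, (X i ω - if 0 ≤ f (Srec X f p q n i ω / n) then p else q) ^ 2
      = {x | 0 ≤ slopeOfVec f p q n i x}.indicator (fun _ => (1 : ℝ)) (initialVec X i ω)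
          * (X i ω - p) ^ 2
        + {x | 0 ≤ slopeOfVec f p q n i x}ᶜ.indicator (fun _ => (1 : ℝ)) (initialVec X i ω)
          * (X i ω - q) ^ 2 := by
    intro ω
    by_cases hs : 0 ≤ f (Srec X f p q n i ω / n)
    · simp [Set.indicator, slopeOfVec_initialVec, hs]
    · simp [Set.indicator, slopeOfVec_initialVec, hs]
  have e1 : ∫ ω, {x | 0 ≤ slopeOfVec f p q n i x}.indicator (fun _ => (1 : ℝ))
        (initialVec X i ω) ∂P θ
      + ∫ ω, {x | 0 ≤ slopeOfVec f p q n i x}ᶜ.indicator (fun _ => (1 : ℝ))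
        (initialVec X i ω) ∂P θ = 1 := by
    rw [← integral_add a1 b1]
    have : ∀ ω, {x | 0 ≤ slopeOfVec f p q n i x}.indicator (fun _ => (1 : ℝ)) (initialVec X i ω)
        + {x | 0 ≤ slopeOfVec f p q n i x}ᶜ.indicator (fun _ => (1 : ℝ)) (initialVec X i ω)
        = 1 := fun ω => Set.indicator_self_add_compl_apply _ _ _
    simp [this]
  simp only [e]
  rw [integral_add a2 b2]
  calc _ ≤ _ := add_le_add a3 b3
    _ = c := by rw [← mul_add, e1, mul_one]

end PartialSums

section Gain

variable {Ω Θ : Type*} [MeasurableSpace Ω] {P : Θ → Measure Ω} {X : ℕ → Ω → ℝ} {M : ℝ}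
  {f : ℝ → ℝ} {L : NNReal}

/-- The increment of `gain`: the slope at the current normalised partial sum times the next
centered term. -/
noncomputable def gainIncr {Ω : Type*} (X : ℕ → Ω → ℝ) (f : ℝ → ℝ) (p q : ℝ) (n j : ℕ) (ω : Ω) :
    ℝ :=
  f (Srec X f p q n j ω / n) * X j ω - maxDrift p q (f (Srec X f p q n j ω / n))

/-- The sum of the slopes times the centered terms: the first-order part of a Taylor expansion
along the partial sums. -/
noncomputable def gain {Ω : Type*} (X : ℕ → Ω → ℝ) (f : ℝ → ℝ) (p q : ℝ) (n i : ℕ) (ω : Ω) : ℝ :=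
  ∑ j ∈ Finset.range i, gainIncr X f p q n j ω

lemma gain_succ {Ω : Type*} (X : ℕ → Ω → ℝ) (f : ℝ → ℝ) (p q : ℝ) (n i : ℕ) (ω : Ω) :
    gain X f p q n (i + 1) ω = gain X f p q n i ω + gainIncr X f p q n i ω :=
  Finset.sum_range_succ _ _

lemma abs_sub_gain_le {Ω : Type*} (X : ℕ → Ω → ℝ) {φ : ℝ → ℝ} (hφ : Differentiable ℝ φ)
    (hL : LipschitzWith L (deriv φ)) (p q : ℝ) (n i : ℕ) (ω : Ω) :
    |φ (Srec X (deriv φ) p q n i ω / n) - φ 0 - gain X (deriv φ) p q n i ω / n|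
      ≤ L / (2 * n ^ 2) * ∑ j ∈ Finset.range i,
        (X j ω - if 0 ≤ deriv φ (Srec X (deriv φ) p q n j ω / n) then p else q) ^ 2 := by
  induction i with
  | zero => simp [Srec, gain]
  | succ i ih =>
    have h := abs_sub_sub_deriv_mul_le hφ hL (Srec X (deriv φ) p q n i ω / n)
      (Srec X (deriv φ) p q n (i + 1) ω / n)
    rw [gain_succ, Finset.sum_range_succ, mul_add]
    set z := X i ω - if 0 ≤ deriv φ (Srec X (deriv φ) p q n i ω / n) then p else q with hz
    have hd : Srec X (deriv φ) p q n (i + 1) ω / n - Srec X (deriv φ) p q n i ω / n = z / n := by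
      simp only [Srec, ← hz]
      ring
    have hg : gainIncr X (deriv φ) p q n i ω = deriv φ (Srec X (deriv φ) p q n i ω / n) * z := by
      rw [gainIncr, maxDrift_eq_ite, hz, mul_sub]
    rw [hd] at h
    rw [hg]
    calc _ = |(φ (Srec X (deriv φ) p q n i ω / n) - φ 0 - gain X (deriv φ) p q n i ω / n)
          + (φ (Srec X (deriv φ) p q n (i + 1) ω / n) - φ (Srec X (deriv φ) p q n i ω / n)
            - deriv φ (Srec X (deriv φ) p q n i ω / n) * (z / n))| := by
          congr 1
          ring
      _ ≤ _ := (abs_add_le _ _).trans (add_le_add ih h)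
      _ = _ := by
          congr 1
          ring

lemma SquareIntegrableIID.integrable_slope_mul (h : SquareIntegrableIID P X M)
    (hf : LipschitzWith L f) (p q : ℝ) (n j : ℕ) (θ : Θ) :
    Integrable (fun ω => f (Srec X f p q n j ω / n) * X j ω) (P θ) :=
  (h.memLp_two_slope hf p q n j θ).integrable_mul (h.memLp_two j θ)

lemma SquareIntegrableIID.integrable_slope (h : SquareIntegrableIID P X M)
    (hf : LipschitzWith L f) (p q : ℝ) (n j : ℕ) (θ : Θ) :
    Integrable (fun ω => f (Srec X f p q n j ω / n)) (P θ) := by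
  have := h.isProbabilityMeasure
  exact (h.memLp_two_slope hf p q n j θ).integrable (by norm_num)

lemma integrable_maxDrift {μ : Measure Ω} {u : Ω → ℝ} (hu : Integrable u μ) (p q : ℝ) :
    Integrable (fun ω => maxDrift p q (u ω)) μ := by
  refine (hu.norm.const_mul (|p| + |q|)).mono'
    ((continuous_maxDrift p q).comp_aestronglyMeasurable hu.aestronglyMeasurable)
    (Eventually.of_forall fun ω => abs_maxDrift_le p q _)

lemma SquareIntegrableIID.integrable_gainIncr (h : SquareIntegrableIID P X M)
    (hf : LipschitzWith L f) (p q : ℝ) (n j : ℕ) (θ : Θ) :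
    Integrable (gainIncr X f p q n j) (P θ) :=
  (h.integrable_slope_mul hf p q n j θ).sub
    (integrable_maxDrift (h.integrable_slope hf p q n j θ) p q)

lemma SquareIntegrableIID.integrable_gain (h : SquareIntegrableIID P X M)
    (hf : LipschitzWith L f) (p q : ℝ) (n i : ℕ) (θ : Θ) :
    Integrable (gain X f p q n i) (P θ) :=
  integrable_finsetSum _ fun j _ => h.integrable_gainIncr hf p q n j θ

lemma SquareIntegrableIID.integral_gain_nonpos [Nonempty Θ] (h : SquareIntegrableIID P X M)
    (hf : LipschitzWith L f) {p q : ℝ} (hp : ∀ θ, ∫ ω, X 0 ω ∂P θ ≤ p)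
    (hq : ∀ θ, q ≤ ∫ ω, X 0 ω ∂P θ) (n i : ℕ) (θ : Θ) : ∫ ω, gain X f p q n i ω ∂P θ ≤ 0 := by
  unfold gain
  rw [integral_finsetSum _ fun j _ => h.integrable_gainIncr hf p q n j θ]
  refine Finset.sum_nonpos fun j _ => ?_
  unfold gainIncr
  rw [integral_sub (h.integrable_slope_mul hf p q n j θ)
    (integrable_maxDrift (h.integrable_slope hf p q n j θ) p q), sub_nonpos]
  have hA := h.integrable_slope hf p q n j θ
  have hAX := h.integrable_slope_mul hf p q n j θ
  simp only [← slopeOfVec_initialVec] at hA hAX ⊢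
  exact h.integral_mul_le_integral_maxDrift hp hq j θ
    (measurable_slopeOfVec hf.continuous p q n j) hA hAX

/-- Replacing the slope `A` by a bounded continuous function, and truncating the next term,
decreases the expected increment of the gain by a controlled amount only. -/
lemma SquareIntegrableIID.integral_truncated_le [Nonempty Θ] (h : SquareIntegrableIID P X M)
    (i : ℕ) (θ : Θ) {A : (Fin i → ℝ) → ℝ} (hA : Measurable A)
    (hAi : Integrable (fun ω => A (initialVec X i ω)) (P θ))
    (hAX : Integrable (fun ω => A (initialVec X i ω) * X i ω) (P θ))
    (g : (Fin i → ℝ) →ᵇ ℝ) {p q p' q' R : ℝ} (hR : 0 < R) (hp : |p - p'| ≤ M / R)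
    (hq : |q - q'| ≤ M / R) :
    ∫ ω, (g (initialVec X i ω) * clip R (X i ω) - maxDrift p' q' (g (initialVec X i ω))) ∂P θ
      ≤ ∫ ω, (A (initialVec X i ω) * X i ω - maxDrift p q (A (initialVec X i ω))) ∂P θ
        + (1 + M + (|p| + |q|)) * ∫ ω, |A (initialVec X i ω) - g (initialVec X i ω)| ∂P θ
        + 2 * ‖g‖ * M / R := by
  have := h.isProbabilityMeasure
  have hv := h.aemeasurable_initialVec i θ
  have hgi : Integrable (fun ω => g (initialVec X i ω)) (P θ) :=
    integrable_of_abs_le (g.continuous.measurable.comp_aemeasurable hv).aestronglyMeasurable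
      fun ω => abs_boundedContinuous_le g _
  have hM : 0 ≤ M := (integral_nonneg fun ω => sq_nonneg _).trans (h.integral_sq_le θ)
  have hD : Integrable (fun ω => |A (initialVec X i ω) - g (initialVec X i ω)|) (P θ) :=
    (hAi.sub hgi).abs
  have hgX : Integrable (fun ω => g (initialVec X i ω) * X i ω) (P θ) :=
    (h.integrable θ i).bdd_mul hgi.aestronglyMeasurable
      (Eventually.of_forall fun ω => abs_boundedContinuous_le g _)
  have hgc : Integrable (fun ω => g (initialVec X i ω) * clip R (X i ω)) (P θ) :=
    (h.integrable_clip i θ hR.le).bdd_mul hgi.aestronglyMeasurable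
      (Eventually.of_forall fun ω => abs_boundedContinuous_le g _)
  have hDX : Integrable
      (fun ω => |A (initialVec X i ω) - g (initialVec X i ω)| * |X i ω|) (P θ) := by
    refine (hAX.sub hgX).abs.congr (Eventually.of_forall fun ω => ?_)
    simp only [Pi.sub_apply, ← sub_mul, abs_mul]
  have hAm : Integrable
      (fun ω => A (initialVec X i ω) * X i ω - maxDrift p q (A (initialVec X i ω))) (P θ) :=
    hAX.sub (integrable_maxDrift hAi p q)
  have hX2 := (h.integrable_sq θ i).const_mul (‖g‖ / R)
  have hDc := hD.const_mul (|p| + |q|)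
  have hAm1 := hAm.add hDX
  have hAm2 := hAm1.add hDc
  have hAm3 := hAm2.add hX2
  have hle : ∫ ω, (g (initialVec X i ω) * clip R (X i ω)
        - maxDrift p' q' (g (initialVec X i ω))) ∂P θ
      ≤ ∫ ω, (((((A (initialVec X i ω) * X i ω - maxDrift p q (A (initialVec X i ω)))
        + |A (initialVec X i ω) - g (initialVec X i ω)| * |X i ω|)
        + (|p| + |q|) * |A (initialVec X i ω) - g (initialVec X i ω)|)
        + ‖g‖ / R * (X i ω) ^ 2) + ‖g‖ * M / R) ∂P θ := by
    refine integral_mono (hgc.sub (integrable_maxDrift hgi p' q'))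
      (hAm3.add (integrable_const _)) fun ω => ?_
    simp only
    have hg := abs_boundedContinuous_le g (initialVec X i ω)
    set a := A (initialVec X i ω)
    set b := g (initialVec X i ω)
    set x := X i ω
    have h1 : b * (clip R x - x) ≤ ‖g‖ / R * x ^ 2 := by
      calc b * (clip R x - x) ≤ |b| * |x - clip R x| := by
            rw [abs_sub_comm, ← abs_mul]; exact le_abs_self _
        _ ≤ ‖g‖ * (x ^ 2 / R) := by gcongr; exact abs_sub_clip_le hR x
        _ = ‖g‖ / R * x ^ 2 := by ring
    have h2 : (b - a) * x ≤ |a - b| * |x| := by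
      rw [abs_sub_comm, ← abs_mul]; exact le_abs_self _
    have h3 := (abs_le.1 (abs_maxDrift_sub_le p q a b)).2
    have h4 := (abs_le.1 (abs_maxDrift_sub_le' hp hq b)).2
    have h5 : M / R * |b| ≤ ‖g‖ * M / R := by
      calc M / R * |b| ≤ M / R * ‖g‖ := by gcongr
        _ = ‖g‖ * M / R := by ring
    linarith
  have e : ∫ ω, (((((A (initialVec X i ω) * X i ω - maxDrift p q (A (initialVec X i ω)))
        + |A (initialVec X i ω) - g (initialVec X i ω)| * |X i ω|)
        + (|p| + |q|) * |A (initialVec X i ω) - g (initialVec X i ω)|)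
        + ‖g‖ / R * (X i ω) ^ 2) + ‖g‖ * M / R) ∂P θ
      = ∫ ω, (A (initialVec X i ω) * X i ω - maxDrift p q (A (initialVec X i ω))) ∂P θ
        + ∫ ω, |A (initialVec X i ω) - g (initialVec X i ω)| * |X i ω| ∂P θ
        + (|p| + |q|) * ∫ ω, |A (initialVec X i ω) - g (initialVec X i ω)| ∂P θ
        + ‖g‖ / R * ∫ ω, (X i ω) ^ 2 ∂P θ + ‖g‖ * M / R := by
    refine (integral_add hAm3 (integrable_const _)).trans ?_
    refine congrArg₂ _ ((integral_add hAm2 hX2).trans ?_) (by simp)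
    refine congrArg₂ _ ((integral_add hAm1 hDc).trans ?_) (integral_const_mul _ _)
    exact congrArg₂ _ (integral_add hAm hDX) (integral_const_mul _ _)
  have hX := h.integral_mul_abs_le i θ (D := fun x => |A x - g x|)
    ((hA.sub g.continuous.measurable).abs) (fun x => abs_nonneg _) hD hDX
  have hX2' : ‖g‖ / R * ∫ ω, (X i ω) ^ 2 ∂P θ ≤ ‖g‖ / R * M :=
    mul_le_mul_of_nonneg_left (h.integral_sq_le' i θ) (by positivity)
  rw [e] at hle
  have e2 : ‖g‖ / R * M + ‖g‖ * M / R = 2 * ‖g‖ * M / R := by ring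
  linarith

end Gain

section NearMaximizers

variable {Ω Θ : Type*} [MeasurableSpace Ω] {P : Θ → Measure Ω} {X : ℕ → Ω → ℝ} {M : ℝ}
  {f : ℝ → ℝ} {L : NNReal}

lemma integral_map_initialVec {μ : Measure Ω} {i : ℕ} (hv : AEMeasurable (initialVec X i) μ)
    (H : (Fin i → ℝ) →ᵇ ℝ) : ∫ x, H x ∂μ.map (initialVec X i) = ∫ ω, H (initialVec X i ω) ∂μ :=
  integral_map hv H.continuous.aestronglyMeasurable

lemma SquareIntegrableIID.SE_map_initialVec (h : SquareIntegrableIID P X M) (i : ℕ)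
    (H : (Fin i → ℝ) →ᵇ ℝ) :
    SE (fun θ => (P θ).map (initialVec X i)) H = SE P (fun ω => H (initialVec X i ω)) := by
  unfold SE
  congr 1
  funext θ
  exact integral_map_initialVec (h.aemeasurable_initialVec i θ) H

/-- The slope at the `i`-th partial sum is uniformly close in `L¹`, on a set of near-maximizers,
to a bounded continuous function of the first `i` terms. -/
lemma SquareIntegrableIID.exists_integral_slope_sub_le [Nonempty Θ]
    (h : SquareIntegrableIID P X M) (hf : LipschitzWith L f) (p q : ℝ) (n i : ℕ)
    (H : (Fin i → ℝ) →ᵇ ℝ) {η : ℝ} (hη : 0 < η) {δ : ℝ} (hδ : 0 < δ) :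
    ∃ (H' : (Fin i → ℝ) →ᵇ ℝ) (η' : ℝ) (g : (Fin i → ℝ) →ᵇ ℝ), 0 < η' ∧
      nearMax (fun θ => (P θ).map (initialVec X i)) H' η' ⊆
        nearMax (fun θ => (P θ).map (initialVec X i)) H η ∧
      ∀ θ ∈ nearMax (fun θ => (P θ).map (initialVec X i)) H' η',
        ∫ ω, |slopeOfVec f p q n i (initialVec X i ω) - g (initialVec X i ω)| ∂P θ ≤ δ := by
  have := h.isProbabilityMeasure
  have hν : ∀ θ, IsProbabilityMeasure ((P θ).map (initialVec X i)) := fun θ =>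
    Measure.isProbabilityMeasure_map (h.aemeasurable_initialVec i θ)
  obtain ⟨K, hK⟩ := h.exists_integral_slope_sq_le hf p q n i
  set N : ℝ := 2 * (|K| + 1) / δ with hN
  have hNpos : 0 < N := by positivity
  have hfc : Continuous fun r : ℝ => f (r / n) := hf.continuous.comp (continuous_id.div_const _)
  obtain ⟨-, -, happ⟩ := approximable_Srec (ν := fun θ => (P θ).map (initialVec X i))
    hf.continuous p q n (clipFun _ hfc N hNpos.le) (i := i)
  obtain ⟨H', η', g, hη', hsub, hg⟩ := happ H η hη (δ / 2) (by positivity)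
  refine ⟨H', η', g, hη', hsub, fun θ hθ => ?_⟩
  have hv := h.aemeasurable_initialVec i θ
  have h1 := hg θ hθ
  change ∫ x, |clip N (slopeOfVec f p q n i x) - g x| ∂(P θ).map (initialVec X i) ≤ δ / 2 at h1
  have hcm : Measurable fun x => clip N (slopeOfVec f p q n i x) :=
    (continuous_clip N).measurable.comp (measurable_slopeOfVec hf.continuous p q n i)
  have hcgm : Measurable fun x => |clip N (slopeOfVec f p q n i x) - g x| :=
    (hcm.sub g.continuous.measurable).abs
  rw [integral_map hv hcgm.aestronglyMeasurable] at h1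
  have hs := h.integrable_slope hf p q n i θ
  have hs2 := (h.memLp_two_slope hf p q n i θ).integrable_sq
  have hK' := hK θ
  simp only [← slopeOfVec_initialVec] at hs hs2 hK'
  have hgi : Integrable (fun ω => g (initialVec X i ω)) (P θ) :=
    integrable_of_abs_le (g.continuous.measurable.comp_aemeasurable hv).aestronglyMeasurable
      fun ω => abs_boundedContinuous_le g _
  have hci : Integrable (fun ω => clip N (slopeOfVec f p q n i (initialVec X i ω))) (P θ) :=
    integrable_of_abs_le (hcm.comp_aemeasurable hv).aestronglyMeasurable
      fun ω => abs_clip_le hNpos.le _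
  have hcg := (hci.sub hgi).abs
  calc ∫ ω, |slopeOfVec f p q n i (initialVec X i ω) - g (initialVec X i ω)| ∂P θ
      ≤ ∫ ω, ((slopeOfVec f p q n i (initialVec X i ω)) ^ 2 / N
        + |clip N (slopeOfVec f p q n i (initialVec X i ω)) - g (initialVec X i ω)|) ∂P θ :=
        integral_mono (hs.sub hgi).abs ((hs2.div_const N).add hcg) fun ω =>
          (abs_sub_le _ (clip N (slopeOfVec f p q n i (initialVec X i ω))) _).trans
            (add_le_add (abs_sub_clip_le hNpos _) le_rfl)
    _ = (∫ ω, (slopeOfVec f p q n i (initialVec X i ω)) ^ 2 ∂P θ) / N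
        + ∫ ω, |clip N (slopeOfVec f p q n i (initialVec X i ω)) - g (initialVec X i ω)| ∂P θ :=
        (integral_add (hs2.div_const N) hcg).trans (congrArg₂ _ (integral_div _ _) rfl)
    _ ≤ δ / 2 + δ / 2 := by
        refine add_le_add ?_ h1
        rw [div_le_iff₀ hNpos, hN]
        have : δ / 2 * (2 * (|K| + 1) / δ) = |K| + 1 := by field_simp
        rw [this]
        linarith [le_abs_self K]
    _ = δ := add_halves δ

/-- The test function on the first `i + 1` terms which extends `H` by the increment of a gain with
slope `g`, the last term being truncated at level `R`. -/
noncomputable def extendGain {i : ℕ} (H g : (Fin i → ℝ) →ᵇ ℝ) (R : ℝ) (hR : 0 ≤ R) (p q : ℝ) :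
    (Fin (i + 1) → ℝ) →ᵇ ℝ :=
  BoundedContinuousFunction.ofNormedAddCommGroup
    (fun x => H (Fin.init x) + (g (Fin.init x) * clip R (x (Fin.last i))
      - maxDrift p q (g (Fin.init x))))
    (by
      have h1 := continuous_clip R
      have h2 := continuous_maxDrift p q
      have h3 : Continuous fun x : Fin (i + 1) → ℝ => (Fin.init x : Fin i → ℝ) :=
        continuous_pi fun j => continuous_apply _
      fun_prop)
    (‖H‖ + (‖g‖ * R + (|p| + |q|) * ‖g‖)) (fun x => by
      refine (norm_add_le _ _).trans (add_le_add (H.norm_coe_le_norm _) ?_)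
      refine (norm_sub_le _ _).trans (add_le_add ?_ ?_)
      · rw [norm_mul]
        exact mul_le_mul (g.norm_coe_le_norm _) (abs_clip_le hR _) (norm_nonneg _) (norm_nonneg _)
      · exact (abs_maxDrift_le p q _).trans
          (mul_le_mul_of_nonneg_left (g.norm_coe_le_norm _) (by positivity)))

lemma extendGain_initialVec {Ω : Type*} (X : ℕ → Ω → ℝ) {i : ℕ} (H g : (Fin i → ℝ) →ᵇ ℝ) {R : ℝ}
    (hR : 0 ≤ R) (p q : ℝ) (ω : Ω) :
    extendGain H g R hR p q (initialVec X (i + 1) ω) = H (initialVec X i ω)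
      + (g (initialVec X i ω) * clip R (X i ω) - maxDrift p q (g (initialVec X i ω))) :=
  rfl

lemma SquareIntegrableIID.SE_extendGain [Nonempty Θ] (h : SquareIntegrableIID P X M) {i : ℕ}
    (H g : (Fin i → ℝ) →ᵇ ℝ) {R : ℝ} (hR : 0 ≤ R) {p q : ℝ}
    (hp : p = SE P (fun ω => clip R (X 0 ω))) (hq : q = -SE P (fun ω => -clip R (X 0 ω))) :
    SE P (fun ω => extendGain H g R hR p q (initialVec X (i + 1) ω))
      = SE P (fun ω => H (initialVec X i ω)) := by
  have := h.isProbabilityMeasure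
  simp only [extendGain_initialVec]
  have h1 := continuous_clip R
  have h2 := continuous_maxDrift p q
  rw [h.SE_initialVec i (fun x y => H x + (g x * clip R y - maxDrift p q (g x))) (by fun_prop)
    ⟨‖H‖ + (‖g‖ * R + (|p| + |q|) * ‖g‖), fun x y => ?_⟩]
  · congr 1
    funext ω
    rw [hp, hq]
    exact SE_add_mul_sub_maxDrift (fun θ => h.integrable_clip 0 θ hR)
      (fun ω => abs_clip_le hR _) _ _
  · refine (abs_add_le _ _).trans (add_le_add (abs_boundedContinuous_le H _) ?_)
    refine (abs_sub _ _).trans (add_le_add ?_ ?_)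
    · rw [abs_mul]
      exact mul_le_mul (abs_boundedContinuous_le g _) (abs_clip_le hR _) (abs_nonneg _)
        (norm_nonneg _)
    · exact (abs_maxDrift_le p q _).trans
        (mul_le_mul_of_nonneg_left (abs_boundedContinuous_le g _) (by positivity))

lemma SquareIntegrableIID.mem_nearMax_of_extendGain [Nonempty Θ] (h : SquareIntegrableIID P X M)
    {i : ℕ} (H g : (Fin i → ℝ) →ᵇ ℝ) {R : ℝ} (hR : 0 ≤ R) {p q : ℝ}
    (hp : p = SE P (fun ω => clip R (X 0 ω))) (hq : q = -SE P (fun ω => -clip R (X 0 ω)))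
    {η : ℝ} {θ : Θ} (hθ : θ ∈ nearMax (fun θ => (P θ).map (initialVec X (i + 1)))
      (extendGain H g R hR p q) η) :
    θ ∈ nearMax (fun θ => (P θ).map (initialVec X i)) H η ∧
      -η < ∫ ω, (g (initialVec X i ω) * clip R (X i ω)
        - maxDrift p q (g (initialVec X i ω))) ∂P θ := by
  have := h.isProbabilityMeasure
  have hv := h.aemeasurable_initialVec i θ
  have hHi : ∀ H : (Fin i → ℝ) →ᵇ ℝ, Integrable (fun ω => H (initialVec X i ω)) (P θ) := fun H =>
    integrable_of_abs_le (H.continuous.measurable.comp_aemeasurable hv).aestronglyMeasurable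
      fun ω => abs_boundedContinuous_le H _
  have hG : Integrable (fun ω => g (initialVec X i ω) * clip R (X i ω)
      - maxDrift p q (g (initialVec X i ω))) (P θ) :=
    ((h.integrable_clip i θ hR).bdd_mul (hHi g).aestronglyMeasurable
      (Eventually.of_forall fun ω => abs_boundedContinuous_le g _)).sub
      (integrable_maxDrift (hHi g) p q)
  have h0 : ∫ ω, (g (initialVec X i ω) * clip R (X i ω)
      - maxDrift p q (g (initialVec X i ω))) ∂P θ ≤ 0 := by
    have h1 := integral_le_SE (P := P)
      (fun ω => abs_boundedContinuous_le (extendGain 0 g R hR p q) (initialVec X (i + 1) ω)) θ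
    rw [h.SE_extendGain 0 g hR hp hq] at h1
    simpa [extendGain_initialVec, SE] using h1
  have hH : ∫ ω, H (initialVec X i ω) ∂P θ ≤ SE P (fun ω => H (initialVec X i ω)) :=
    integral_le_SE (fun ω => abs_boundedContinuous_le H _) θ
  simp only [nearMax, Set.mem_ofPred_eq] at hθ ⊢
  rw [h.SE_map_initialVec, integral_map_initialVec (h.aemeasurable_initialVec _ θ),
    h.SE_extendGain H g hR hp hq] at hθ
  simp only [extendGain_initialVec] at hθ
  rw [integral_add (hHi H) hG] at hθ
  rw [h.SE_map_initialVec, integral_map_initialVec hv]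
  constructor <;> linarith

lemma SquareIntegrableIID.abs_integral_le (h : SquareIntegrableIID P X M) (θ : Θ) :
    |∫ ω, X 0 ω ∂P θ| ≤ 1 + M :=
  abs_integral_le_integral_abs.trans (h.integral_abs_le θ)

lemma SquareIntegrableIID.bddAbove_integral (h : SquareIntegrableIID P X M) :
    BddAbove (Set.range fun θ => ∫ ω, X 0 ω ∂P θ) :=
  ⟨1 + M, by rintro _ ⟨θ, rfl⟩; exact (le_abs_self _).trans (h.abs_integral_le θ)⟩

lemma SquareIntegrableIID.bddAbove_integral_neg (h : SquareIntegrableIID P X M) :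
    BddAbove (Set.range fun θ => ∫ ω, -X 0 ω ∂P θ) :=
  ⟨1 + M, by
    rintro _ ⟨θ, rfl⟩
    simp only [integral_neg]
    exact (neg_le_abs _).trans (h.abs_integral_le θ)⟩

lemma SquareIntegrableIID.abs_SE_sub_SE_clip_le [Nonempty Θ] (h : SquareIntegrableIID P X M)
    {R : ℝ} (hR : 0 < R) : |SE P (X 0) - SE P (fun ω => clip R (X 0 ω))| ≤ M / R := by
  have := h.isProbabilityMeasure
  refine abs_SE_sub_le h.bddAbove_integral ⟨R, ?_⟩ fun θ => h.abs_integral_sub_clip_le θ hR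
  rintro _ ⟨θ, rfl⟩
  exact (le_abs_self _).trans (abs_integral_le_of_abs_le fun ω => abs_clip_le hR.le _)

lemma SquareIntegrableIID.abs_SE_neg_sub_SE_neg_clip_le [Nonempty Θ]
    (h : SquareIntegrableIID P X M) {R : ℝ} (hR : 0 < R) :
    |-SE P (fun ω => -X 0 ω) - -SE P (fun ω => -clip R (X 0 ω))| ≤ M / R := by
  have := h.isProbabilityMeasure
  rw [neg_sub_neg, abs_sub_comm]
  refine abs_SE_sub_le h.bddAbove_integral_neg ⟨R, ?_⟩ fun θ => ?_
  · rintro _ ⟨θ, rfl⟩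
    refine (le_abs_self _).trans (abs_integral_le_of_abs_le fun ω => ?_)
    rw [abs_neg]
    exact abs_clip_le hR.le _
  · rw [integral_neg, integral_neg, neg_sub_neg, abs_sub_comm]
    exact h.abs_integral_sub_clip_le θ hR

/-- On a suitable set of near-maximizers, the expected gain is almost nonnegative. -/
lemma SquareIntegrableIID.exists_nearMax_gain [Nonempty Θ] (h : SquareIntegrableIID P X M)
    (hf : LipschitzWith L f) {p q : ℝ} (hp : p = SE P (X 0)) (hq : q = -SE P (fun ω => -X 0 ω))
    (n i : ℕ) : ∀ ε : ℝ, 0 < ε → ∃ (H : (Fin i → ℝ) →ᵇ ℝ) (η : ℝ), 0 < η ∧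
      ∀ θ ∈ nearMax (fun θ => (P θ).map (initialVec X i)) H η,
        -ε ≤ ∫ ω, gain X f p q n i ω ∂P θ := by
  induction i with
  | zero => exact fun ε hε => ⟨0, 1, one_pos, fun θ _ => by simpa [gain] using hε.le⟩
  | succ i ih =>
    intro ε hε
    have hM : 0 ≤ M := by
      obtain ⟨θ⟩ := ‹Nonempty Θ›
      exact (integral_nonneg fun ω => sq_nonneg _).trans (h.integral_sq_le θ)
    obtain ⟨H, η, hη, hH⟩ := ih (ε / 2) (half_pos hε)
    set C := 1 + M + (|p| + |q|) with hC
    have hCpos : 0 < C := by positivity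
    obtain ⟨H', η', g, hη', hsub, hg⟩ :=
      h.exists_integral_slope_sub_le hf p q n i H hη (δ := ε / (8 * C)) (by positivity)
    set R : ℝ := 16 * (‖g‖ * M + 1) / ε with hRdef
    have hR : 0 < R := by positivity
    refine ⟨extendGain H' g R hR.le (SE P fun ω => clip R (X 0 ω))
      (-SE P fun ω => -clip R (X 0 ω)), min η' (ε / 8), lt_min hη' (by positivity),
      fun θ hθ => ?_⟩
    obtain ⟨hθ', hG⟩ := h.mem_nearMax_of_extendGain H' g hR.le rfl rfl hθ
    have hθ'' : θ ∈ nearMax (fun θ => (P θ).map (initialVec X i)) H' η' := by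
      simp only [nearMax, Set.mem_ofPred_eq] at hθ' ⊢
      linarith [min_le_left η' (ε / 8)]
    have h1 := hH θ (hsub hθ'')
    have h2 := hg θ hθ''
    have hA := h.integrable_slope hf p q n i θ
    have hAX := h.integrable_slope_mul hf p q n i θ
    have e : ∫ ω, gain X f p q n (i + 1) ω ∂P θ = ∫ ω, gain X f p q n i ω ∂P θ
        + ∫ ω, gainIncr X f p q n i ω ∂P θ := by
      simp only [gain_succ]
      exact integral_add (h.integrable_gain hf p q n i θ) (h.integrable_gainIncr hf p q n i θ)
    have e2 : ∀ ω, gainIncr X f p q n i ω = slopeOfVec f p q n i (initialVec X i ω) * X i ω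
        - maxDrift p q (slopeOfVec f p q n i (initialVec X i ω)) := fun ω => by
      rw [slopeOfVec_initialVec, gainIncr]
    simp only [← slopeOfVec_initialVec] at hA hAX
    have h3 := h.integral_truncated_le i θ (measurable_slopeOfVec hf.continuous p q n i) hA hAX g
      hR (hp ▸ h.abs_SE_sub_SE_clip_le hR) (hq ▸ h.abs_SE_neg_sub_SE_neg_clip_le hR)
    simp only [← e2, ← hC] at h3
    have h4 : C * ∫ ω, |slopeOfVec f p q n i (initialVec X i ω) - g (initialVec X i ω)| ∂P θ
        ≤ ε / 8 := by
      calc _ ≤ C * (ε / (8 * C)) := mul_le_mul_of_nonneg_left h2 hCpos.le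
        _ = ε / 8 := by field_simp
    have h5 : 2 * ‖g‖ * M / R ≤ ε / 8 := by
      rw [div_le_iff₀ hR, hRdef]
      have : ε / 8 * (16 * (‖g‖ * M + 1) / ε) = 2 * (‖g‖ * M + 1) := by field_simp; norm_num
      rw [this]
      linarith
    rw [e]
    linarith [min_le_right η' (ε / 8)]

lemma SquareIntegrableIID.exists_neg_le_integral_gain [Nonempty Θ] (h : SquareIntegrableIID P X M)
    (hf : LipschitzWith L f) {p q : ℝ} (hp : p = SE P (X 0)) (hq : q = -SE P (fun ω => -X 0 ω))
    (n i : ℕ) {ε : ℝ} (hε : 0 < ε) : ∃ θ, -ε ≤ ∫ ω, gain X f p q n i ω ∂P θ := by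
  obtain ⟨H, η, hη, hH⟩ := h.exists_nearMax_gain hf hp hq n i ε hε
  obtain ⟨θ, hθ⟩ := exists_lt_of_lt_ciSup
    (show SE (fun θ => (P θ).map (initialVec X i)) H - η
      < ⨆ θ, ∫ x, H x ∂(P θ).map (initialVec X i) from sub_lt_self _ hη)
  exact ⟨θ, hH θ hθ⟩

end NearMaximizers

section Estimate

variable {Ω Θ : Type*} [MeasurableSpace Ω] {P : Θ → Measure Ω} {X : ℕ → Ω → ℝ} {M : ℝ}

lemma SquareIntegrableIID.integral_sub_sq_eq (h : SquareIntegrableIID P X M) (θ : Θ) (r : ℝ) :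
    ∫ ω, (X 0 ω - r) ^ 2 ∂P θ = ∫ ω, (X 0 ω - ∫ ω', X 0 ω' ∂P θ) ^ 2 ∂P θ
      + (∫ ω, X 0 ω ∂P θ - r) ^ 2 := by
  have := h.isProbabilityMeasure
  set m := ∫ ω, X 0 ω ∂P θ with hm
  have h1 : Integrable (fun ω => (X 0 ω - m) ^ 2) (P θ) :=
    ((h.memLp_two 0 θ).sub (memLp_const m)).integrable_sq
  have h2 : Integrable (fun ω => 2 * (m - r) * (X 0 ω - m)) (P θ) :=
    ((h.integrable θ 0).sub (integrable_const m)).const_mul _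
  have h3 : Integrable (fun ω => (X 0 ω - m) ^ 2 + 2 * (m - r) * (X 0 ω - m)) (P θ) := h1.add h2
  have e : ∀ ω, (X 0 ω - r) ^ 2
      = (X 0 ω - m) ^ 2 + 2 * (m - r) * (X 0 ω - m) + (m - r) ^ 2 := fun ω => by ring
  simp only [e]
  rw [integral_add h3 (integrable_const _), integral_add h1 h2, integral_const_mul,
    integral_sub (h.integrable θ 0) (integrable_const m)]
  simp [← hm]

lemma SquareIntegrableIID.bddAbove_variance (h : SquareIntegrableIID P X M) :
    BddAbove (Set.range fun θ => ∫ ω, (X 0 ω - ∫ ω', X 0 ω' ∂P θ) ^ 2 ∂P θ) := by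
  refine ⟨M, ?_⟩
  rintro _ ⟨θ, rfl⟩
  have h1 := h.integral_sub_sq_eq θ 0
  simp only [sub_zero] at h1
  linarith [h.integral_sq_le θ, sq_nonneg (∫ ω, X 0 ω ∂P θ)]

lemma SquareIntegrableIID.integral_sub_sq_le (h : SquareIntegrableIID P X M) {p q r : ℝ}
    (hp : ∀ θ, ∫ ω, X 0 ω ∂P θ ≤ p) (hq : ∀ θ, q ≤ ∫ ω, X 0 ω ∂P θ) (hrp : r ≤ p) (hqr : q ≤ r)
    (θ : Θ) : ∫ ω, (X 0 ω - r) ^ 2 ∂P θ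
      ≤ (⨆ θ, ∫ ω, (X 0 ω - ∫ ω', X 0 ω' ∂P θ) ^ 2 ∂P θ) + (p - q) ^ 2 := by
  rw [h.integral_sub_sq_eq θ r]
  refine add_le_add (le_ciSup h.bddAbove_variance θ) (sq_le_sq' ?_ ?_)
  · linarith [hq θ]
  · linarith [hp θ]

lemma SquareIntegrableIID.abs_integral_sub_gain_le [Nonempty Θ] (h : SquareIntegrableIID P X M)
    {φ : ℝ → ℝ} (hφ : Differentiable ℝ φ) {L : NNReal} (hL : LipschitzWith L (deriv φ))
    {p q c : ℝ} (hp : ∀ θ, ∫ ω, (X 0 ω - p) ^ 2 ∂P θ ≤ c)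
    (hq : ∀ θ, ∫ ω, (X 0 ω - q) ^ 2 ∂P θ ≤ c) {n : ℕ} (hn : 1 ≤ n) (θ : Θ) :
    |∫ ω, φ (Srec X (deriv φ) p q n n ω / n) ∂P θ - φ 0
      - (∫ ω, gain X (deriv φ) p q n n ω ∂P θ) / n| ≤ c / 2 * L / n := by
  have := h.isProbabilityMeasure
  have hf := hL.continuous
  have hS := h.memLp_two_Srec hf p q n n θ
  have hSn : MemLp (fun ω => Srec X (deriv φ) p q n n ω / n) 2 (P θ) := by
    simpa only [div_eq_mul_inv] using hS.mul_const (n : ℝ)⁻¹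
  have hφi : Integrable (fun ω => φ (Srec X (deriv φ) p q n n ω / n)) (P θ) := by
    have hb : Integrable (fun ω => (|φ 0| + |deriv φ 0| * |Srec X (deriv φ) p q n n ω / n|)
        + L / 2 * (Srec X (deriv φ) p q n n ω / n) ^ 2) (P θ) :=
      ((integrable_const _).add ((hSn.integrable (by norm_num)).abs.const_mul _)).add
        (hSn.integrable_sq.const_mul _)
    refine hb.mono' (hφ.continuous.comp_aestronglyMeasurable hSn.aestronglyMeasurable)
      (Eventually.of_forall fun ω => ?_)
    set y := Srec X (deriv φ) p q n n ω / n
    have h1 := abs_sub_sub_deriv_mul_le hφ hL 0 y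
    rw [sub_zero] at h1
    calc ‖φ y‖ = |(φ 0 + deriv φ 0 * y) + (φ y - φ 0 - deriv φ 0 * y)| := by
          rw [Real.norm_eq_abs]; congr 1; ring
      _ ≤ _ := (abs_add_le _ _).trans (add_le_add ((abs_add_le _ _).trans
          (add_le_add le_rfl (abs_mul _ _).le)) h1)
  have hg := (h.integrable_gain hL p q n n θ).div_const (n : ℝ)
  have hφ0 : Integrable (fun ω => φ (Srec X (deriv φ) p q n n ω / n) - φ 0) (P θ) :=
    hφi.sub (integrable_const _)
  have hsq : ∀ j, Integrable (fun ω =>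
      (X j ω - if 0 ≤ deriv φ (Srec X (deriv φ) p q n j ω / n) then p else q) ^ 2) (P θ) :=
    fun j => ((h.memLp_two j θ).sub (h.memLp_two_centering hf p q n j θ)).integrable_sq
  have e : ∫ ω, φ (Srec X (deriv φ) p q n n ω / n) ∂P θ - φ 0
      - (∫ ω, gain X (deriv φ) p q n n ω ∂P θ) / n
      = ∫ ω, (φ (Srec X (deriv φ) p q n n ω / n) - φ 0 - gain X (deriv φ) p q n n ω / n) ∂P θ := by
    rw [integral_sub hφ0 hg, integral_sub hφi (integrable_const _), integral_div]
    simp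
  rw [e]
  calc _ ≤ ∫ ω, |φ (Srec X (deriv φ) p q n n ω / n) - φ 0 - gain X (deriv φ) p q n n ω / n| ∂P θ :=
        abs_integral_le_integral_abs
    _ ≤ ∫ ω, L / (2 * n ^ 2) * ∑ j ∈ Finset.range n,
          (X j ω - if 0 ≤ deriv φ (Srec X (deriv φ) p q n j ω / n) then p else q) ^ 2 ∂P θ :=
        integral_mono (hφ0.sub hg).abs
          ((integrable_finsetSum _ fun j _ => hsq j).const_mul _)
          fun ω => abs_sub_gain_le X hφ hL p q n n ω
    _ ≤ L / (2 * n ^ 2) * (n * c) := by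
        rw [integral_const_mul, integral_finsetSum _ fun j _ => hsq j]
        refine mul_le_mul_of_nonneg_left ?_ (by positivity)
        refine (Finset.sum_le_sum fun j _ =>
          h.integral_sub_centering_sq_le hf p q n j θ hp hq).trans ?_
        simp
    _ = c / 2 * L / n := by
        have : (n : ℝ) ≠ 0 := by positivity
        field_simp

end Estimate

/-- A new law of large numbers with rate of convergence:
`|𝔼[φ(Σ(X_i − μ_i)/n)] − φ(0)| ≤ C₀‖φ''‖/n` with `C₀ = (σ̄² + (μ̄ − μ_)²)/2`. -/
theorem stmt4 {Ω Θ : Type*} [MeasurableSpace Ω] [Nonempty Θ]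
    (P : Θ → Measure Ω) (hP : ∀ θ, IsProbabilityMeasure (P θ))
    (X : ℕ → Ω → ℝ) (hiid : SEiid P X)
    (hInt : ∀ θ i, Integrable (X i) (P θ))
    (hInt2 : ∀ θ i, Integrable (fun ω => (X i ω) ^ 2) (P θ))
    (hBdd2 : BddAbove (Set.range fun θ => ∫ ω, (X 0 ω) ^ 2 ∂(P θ)))
    (μbar μlow σbarSq : ℝ)
    (hμbar : μbar = SE P (X 0))
    (hμlow : μlow = -SE P (fun ω => -X 0 ω))
    (hσbarSq : σbarSq = ⨆ θ, ∫ ω, (X 0 ω - ∫ ω', X 0 ω' ∂(P θ)) ^ 2 ∂(P θ))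
    (φ : ℝ → ℝ) (hφ : Differentiable ℝ φ)
    (L : NNReal) (hL : LipschitzWith L (deriv φ))
    (n : ℕ) (hn : 1 ≤ n) :
    |SE P (fun ω => φ (Srec X (deriv φ) μbar μlow n n ω / n)) - φ 0|
      ≤ (σbarSq + (μbar - μlow) ^ 2) / 2 * L / n := by
  obtain ⟨M, hM⟩ := hBdd2
  have h : SquareIntegrableIID P X M := ⟨hP, hiid, hInt, hInt2, fun θ => hM ⟨θ, rfl⟩⟩
  have hp : ∀ θ, ∫ ω, X 0 ω ∂P θ ≤ μbar := fun θ => by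
    rw [hμbar]
    exact le_ciSup h.bddAbove_integral θ
  have hq : ∀ θ, μlow ≤ ∫ ω, X 0 ω ∂P θ := fun θ => by
    have := le_ciSup h.bddAbove_integral_neg θ
    rw [integral_neg] at this
    rw [hμlow]
    exact neg_le.1 this
  have hqp : μlow ≤ μbar := (hq (Classical.arbitrary Θ)).trans (hp _)
  have hest := fun θ => abs_le.1 (h.abs_integral_sub_gain_le hφ hL
    (h.integral_sub_sq_le hp hq le_rfl hqp) (h.integral_sub_sq_le hp hq hqp le_rfl) hn θ)
  rw [← hσbarSq] at hest
  have hn0 : (0 : ℝ) < n := by exact_mod_cast hn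
  have hup : ∀ θ, ∫ ω, φ (Srec X (deriv φ) μbar μlow n n ω / n) ∂P θ
      ≤ φ 0 + (σbarSq + (μbar - μlow) ^ 2) / 2 * L / n := fun θ => by
    have := div_nonpos_of_nonpos_of_nonneg (h.integral_gain_nonpos hL hp hq n n θ) hn0.le
    linarith [(hest θ).2]
  rw [abs_le]
  constructor
  · refine le_of_forall_pos_le_add fun ε hε => ?_
    obtain ⟨θ, hθ⟩ := h.exists_neg_le_integral_gain hL hμbar hμlow n n (mul_pos hε hn0)
    have h1 : -ε ≤ (∫ ω, gain X (deriv φ) μbar μlow n n ω ∂P θ) / n := by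
      rw [le_div_iff₀ hn0]
      linarith
    have h2 : ∫ ω, φ (Srec X (deriv φ) μbar μlow n n ω / n) ∂P θ
        ≤ SE P (fun ω => φ (Srec X (deriv φ) μbar μlow n n ω / n)) :=
      le_ciSup (f := fun θ => ∫ ω, φ (Srec X (deriv φ) μbar μlow n n ω / n) ∂P θ)
        ⟨_, by rintro _ ⟨θ, rfl⟩; exact hup θ⟩ θ
    linarith [(hest θ).1]
  · have : SE P (fun ω => φ (Srec X (deriv φ) μbar μlow n n ω / n))
        ≤ φ 0 + (σbarSq + (μbar - μlow) ^ 2) / 2 * L / n := ciSup_le hup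
    linarith
end

section
/- Let ξ be a real random variable under the sublinear expectation 𝔼 such that 𝔼[ξ] = −𝔼[−ξ] = 0, 𝔼[ξ²] = a for some a > 0, and 𝔼[|ξ|³] < ∞. Let φ : ℝ → ℝ be convex and Lipschitz with Lipschitz constant ‖φ'‖, let s ≥ 0, and let ϕ_σ denote the density of N(0, σ²) for σ > 0, with the convention that φ ∗ ϕ_0 := φ, where ∗ denotes convolution. Then for every w ∈ ℝ, |𝔼[(φ ∗ ϕ_s)(w + ξ)] − (φ ∗ ϕ_{√(s²+a)})(w)| ≤ ‖φ'‖ (2a^{3/2} + 𝔼[|ξ|³]) / (s² + a). -/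
open MeasureTheory

open ProbabilityTheory Real Set

lemma hasDerivAt_gaussianPDFReal_zero_one (x : ℝ) :
    HasDerivAt (gaussianPDFReal 0 1) (-(x * gaussianPDFReal 0 1 x)) x := by
  have h : HasDerivAt (fun x : ℝ => -(x - 0) ^ 2 / (2 * ((1 : NNReal) : ℝ))) (-x) x := by
    have := ((((hasDerivAt_id x).sub_const 0).pow 2).neg).div_const (2 * ((1 : NNReal) : ℝ))
    exact this.congr_deriv (by simp; ring)
  have := (h.exp).const_mul (√(2 * π * ((1 : NNReal) : ℝ)))⁻¹
  rw [gaussianPDFReal_def]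
  exact this.congr_deriv (by ring)

lemma gaussianPDFReal_zero_one_le (x : ℝ) : gaussianPDFReal 0 1 x ≤ exp (-x ^ 2 / 2) := by
  have h1 : 1 ≤ √(2 * π * ((1 : NNReal) : ℝ)) := by
    rw [Real.one_le_sqrt]
    have := Real.pi_gt_three
    push_cast
    linarith
  have h2 := inv_le_one_of_one_le₀ h1
  rw [gaussianPDFReal_def]
  calc (√(2 * π * ((1 : NNReal) : ℝ)))⁻¹ * exp (-(x - 0) ^ 2 / (2 * ((1 : NNReal) : ℝ)))
      ≤ 1 * exp (-(x - 0) ^ 2 / (2 * ((1 : NNReal) : ℝ))) := by gcongr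
    _ = _ := by simp

lemma abs_mul_gaussianPDFReal_le {p x C : ℝ} (hp : |p| ≤ C * (x ^ 2 / 4 + 1)) (hC : 0 ≤ C) :
    |p * gaussianPDFReal 0 1 x| ≤ C * exp (-x ^ 2 / 4) := by
  rw [abs_mul, abs_of_nonneg (gaussianPDFReal_nonneg _ _ _)]
  calc |p| * gaussianPDFReal 0 1 x ≤ (C * exp (x ^ 2 / 4)) * exp (-x ^ 2 / 2) := by
        gcongr
        · exact gaussianPDFReal_nonneg _ _ _
        · exact hp.trans (mul_le_mul_of_nonneg_left (Real.add_one_le_exp _) hC)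
        · exact gaussianPDFReal_zero_one_le x
    _ = _ := by rw [mul_assoc, ← Real.exp_add]; ring_nf

lemma integrable_add_mul_abs_mul_exp {b : ℝ} (hb : 0 < b) (A M x₀ : ℝ) :
    Integrable (fun y : ℝ => (A + M * |y - x₀|) * exp (-b * (y - x₀) ^ 2)) := by
  have h1 := (integrable_exp_neg_mul_sq hb).const_mul A
  have h2 := (integrable_mul_exp_neg_mul_sq hb).norm.const_mul M
  refine Integrable.comp_sub_right (f := fun y : ℝ => (A + M * |y|) * exp (-b * y ^ 2)) ?_ x₀
  refine (h1.add h2).congr (.of_forall fun y => ?_)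
  simp
  ring

lemma LipschitzWith.abs_le_add_mul {M : NNReal} {ψ : ℝ → ℝ} (hψ : LipschitzWith M ψ) (x y : ℝ) :
    |ψ y| ≤ |ψ x| + M * |y - x| := by
  have := hψ.dist_le_mul y x
  rw [Real.dist_eq, Real.dist_eq] at this
  have h2 := abs_sub_abs_le_abs_sub (ψ y) (ψ x)
  linarith

lemma hasDerivAt_integral_mul_comp_sub {M : NNReal} {ψ q q' : ℝ → ℝ} (hψ : LipschitzWith M ψ)
    (hq : ∀ u, HasDerivAt q (q' u) u) (hq' : Continuous q') {C : ℝ}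
    (hqC : ∀ u, |q u| ≤ C * exp (-u ^ 2 / 4)) (hqC' : ∀ u, |q' u| ≤ C * exp (-u ^ 2 / 4)) (x₀ : ℝ) :
    HasDerivAt (fun x => ∫ y, ψ y * q (y - x)) (-∫ y, ψ y * q' (y - x₀)) x₀ := by
  have hqc : Continuous q := continuous_iff_continuousAt.2 fun u => (hq u).continuousAt
  have hψc := hψ.continuous
  have hC : 0 ≤ C := by
    have := (abs_nonneg _).trans (hqC 0)
    simpa using this
  have key : ∀ g : ℝ → ℝ, (∀ u, |g u| ≤ C * exp (-u ^ 2 / 4)) → ∀ x ∈ Metric.ball x₀ 1, ∀ y,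
      |ψ y * g (y - x)| ≤
        C * exp (1 / 4) * ((|ψ x₀| + M * |y - x₀|) * exp (-(1 / 8) * (y - x₀) ^ 2)) := by
    intro g hg x hx y
    rw [Metric.mem_ball, Real.dist_eq, abs_lt] at hx
    rw [abs_mul]
    calc |ψ y| * |g (y - x)| ≤ (|ψ x₀| + M * |y - x₀|) * (C * exp (-(y - x) ^ 2 / 4)) := by
          gcongr
          · exact hψ.abs_le_add_mul x₀ y
          · exact hg _
      _ ≤ (|ψ x₀| + M * |y - x₀|) * (C * exp (1 / 4 + -(1 / 8) * (y - x₀) ^ 2)) := by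
          gcongr
          nlinarith [sq_nonneg ((y - x) - (x - x₀)), mul_nonneg (sub_nonneg.2 hx.1.le)
            (sub_nonneg.2 hx.2.le)]
      _ = _ := by rw [Real.exp_add]; ring
  have hbound := (integrable_add_mul_abs_mul_exp (b := 1 / 8) (by norm_num) |ψ x₀| M x₀).const_mul
    (C * exp (1 / 4))
  have := (hasDerivAt_integral_of_dominated_loc_of_deriv_le (μ := volume) (x₀ := x₀)
    (F := fun x y => ψ y * q (y - x)) (F' := fun x y => ψ y * -q' (y - x))
    (Metric.ball_mem_nhds x₀ one_pos) ?_ ?_ ?_ ?_ hbound ?_).2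
  · simpa [integral_neg] using this
  · exact .of_forall fun x => (by fun_prop : Continuous _).aestronglyMeasurable
  · refine hbound.mono' (by fun_prop : Continuous _).aestronglyMeasurable (.of_forall fun y => ?_)
    exact key q hqC x₀ (Metric.mem_ball_self one_pos) y
  · exact (by fun_prop : Continuous _).aestronglyMeasurable
  · refine .of_forall fun y x hx => ?_
    rw [mul_neg, norm_neg]
    exact key q' hqC' x hx y
  · refine .of_forall fun y x _ => ?_
    have := ((hq (y - x)).comp x ((hasDerivAt_id x).const_sub y)).const_mul (ψ y)
    simpa [Function.comp_def] using this

lemma abs_sub_taylor_two_le {g g' g'' : ℝ → ℝ} {K : ℝ}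
    (hg : ∀ x, HasDerivAt g (g' x) x) (hg' : ∀ x, HasDerivAt g' (g'' x) x)
    (hK : ∀ x, |g'' x - g'' 0| ≤ K * |x|) (x : ℝ) :
    |g x - g 0 - g' 0 * x - g'' 0 * x ^ 2 / 2| ≤ K * |x| ^ 3 / 6 := by
  wlog hx : 0 ≤ x generalizing g g' g'' x
  · have h1 : ∀ y, HasDerivAt (fun y => g (-y)) (-g' (-y)) y := fun y => by
      simpa [Function.comp_def] using (hg (-y)).comp y (hasDerivAt_neg y)
    have h2 : ∀ y, HasDerivAt (fun y => -g' (-y)) (g'' (-y)) y := fun y => by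
      exact ((hg' (-y)).comp y (hasDerivAt_neg y)).neg.congr_deriv (by simp)
    have := this h1 h2 (fun y => by simpa using hK (-y)) (-x) (by linarith)
    simpa using this
  have h1 : ∀ y, 0 ≤ y → |g' y - g' 0 - g'' 0 * y| ≤ K * y ^ 2 / 2 := by
    intro y hy
    have hd : ∀ z, HasDerivAt (fun z => g' z - g' 0 - g'' 0 * z) (g'' z - g'' 0) z := fun z => by
      exact (((hg' z).sub_const (g' 0)).sub ((hasDerivAt_id z).const_mul (g'' 0))).congr_deriv
        (by simp)
    refine image_norm_le_of_norm_deriv_right_le_deriv_boundary (a := 0) (b := y)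
      (B := fun z => K * z ^ 2 / 2) (B' := fun z => K * z)
      (fun z _ => (hd z).continuousAt.continuousWithinAt) (fun z _ => (hd z).hasDerivWithinAt)
      (by simp) (fun z => ?_) (fun z hz => ?_) (right_mem_Icc.2 hy)
    · exact (((hasDerivAt_pow 2 z).const_mul K).div_const 2).congr_deriv (by push_cast; ring)
    · simpa [abs_of_nonneg hz.1] using hK z
  have hd : ∀ z, HasDerivAt (fun z => g z - g 0 - g' 0 * z - g'' 0 * z ^ 2 / 2)
      (g' z - g' 0 - g'' 0 * z) z := fun z => by
    exact ((((hg z).sub_const (g 0)).sub ((hasDerivAt_id z).const_mul (g' 0))).sub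
      (((hasDerivAt_pow 2 z).const_mul (g'' 0)).div_const 2)).congr_deriv (by push_cast; ring)
  rw [abs_of_nonneg hx]
  refine image_norm_le_of_norm_deriv_right_le_deriv_boundary (a := 0) (b := x)
    (B := fun z => K * z ^ 3 / 6) (B' := fun z => K * z ^ 2 / 2)
    (fun z _ => (hd z).continuousAt.continuousWithinAt) (fun z _ => (hd z).hasDerivWithinAt)
    (by simp) (fun z => ?_) (fun z hz => h1 z hz.1) (right_mem_Icc.2 hx)
  exact (((hasDerivAt_pow 3 z).const_mul K).div_const 6).congr_deriv (by push_cast; ring)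

lemma integral_sq_gaussianReal_zero_one : ∫ z, z ^ 2 ∂gaussianReal 0 1 = 1 := by
  have h := variance_fun_id_gaussianReal (μ := 0) (v := 1)
  rw [variance_of_integral_eq_zero (by fun_prop) integral_id_gaussianReal] at h
  simpa using h

lemma integrable_pow_gaussianReal_zero_one (n : ℕ) :
    Integrable (fun z : ℝ => z ^ n) (gaussianReal 0 1) := by
  have h := (memLp_id_gaussianReal (μ := 0) (v := 1) (n : NNReal)).integrable_norm_pow'
  exact h.mono' (by fun_prop) (.of_forall fun z => by simp)

lemma integrable_gaussianReal_zero_one_iff {f : ℝ → ℝ} :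
    Integrable f (gaussianReal 0 1) ↔ Integrable (fun z => f z * gaussianPDFReal 0 1 z) := by
  rw [gaussianReal_of_var_ne_zero _ one_ne_zero,
    integrable_withDensity_iff (measurable_gaussianPDF _ _) (.of_forall fun _ => gaussianPDF_lt_top)]
  simp [toReal_gaussianPDF]

lemma integral_pow_four_gaussianReal_zero_one : ∫ z, z ^ 4 ∂gaussianReal 0 1 = 3 := by
  have hi := fun n => integrable_gaussianReal_zero_one_iff.1 (integrable_pow_gaussianReal_zero_one n)
  have h0 := integral_eq_zero_of_hasDerivAt_of_integrable
    (f := fun z => z ^ 3 * gaussianPDFReal 0 1 z)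
    (f' := fun z => 3 * (z ^ 2 * gaussianPDFReal 0 1 z) - z ^ 4 * gaussianPDFReal 0 1 z)
    (fun z => by
      exact ((hasDerivAt_pow 3 z).mul (hasDerivAt_gaussianPDFReal_zero_one z)).congr_deriv
        (by push_cast; ring)) (((hi 2).const_mul 3).sub (hi 4)) (hi 3)
  rw [integral_sub ((hi 2).const_mul 3) (hi 4), integral_const_mul] at h0
  have h2 := integral_sq_gaussianReal_zero_one
  rw [integral_gaussianReal_eq_integral_smul one_ne_zero] at h2 ⊢
  simp only [smul_eq_mul, mul_comm (gaussianPDFReal 0 1 _)] at h2 ⊢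
  linarith

lemma integrable_abs_cube_gaussianReal_zero_one :
    Integrable (fun z : ℝ => |z| ^ 3) (gaussianReal 0 1) := by
  simpa [abs_pow] using (integrable_pow_gaussianReal_zero_one 3).abs

lemma integral_abs_cube_gaussianReal_zero_one_le : ∫ z, |z| ^ 3 ∂gaussianReal 0 1 ≤ 2 := by
  have h2 := integrable_pow_gaussianReal_zero_one 2
  have h4 := integrable_pow_gaussianReal_zero_one 4
  calc ∫ z, |z| ^ 3 ∂gaussianReal 0 1 ≤ ∫ z, (z ^ 2 + z ^ 4) / 2 ∂gaussianReal 0 1 := by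
        refine integral_mono integrable_abs_cube_gaussianReal_zero_one ((h2.add h4).div_const 2)
          fun z => ?_
        have h4' : z ^ 4 = |z| ^ 4 := by rw [← abs_pow, abs_of_nonneg (by positivity)]
        dsimp only
        rw [h4', ← sq_abs z]
        nlinarith [sq_nonneg (|z| * (|z| - 1))]
    _ = 2 := by
        rw [integral_div, integral_add h2 h4, integral_sq_gaussianReal_zero_one,
          integral_pow_four_gaussianReal_zero_one]
        norm_num

lemma LipschitzWith.integrable_comp {Ω : Type*} [MeasurableSpace Ω] {μ : Measure Ω}
    [IsFiniteMeasure μ] {M : NNReal} {ψ : ℝ → ℝ} (hψ : LipschitzWith M ψ) {X : Ω → ℝ}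
    (hX : Integrable X μ) : Integrable (fun ω => ψ (X ω)) μ := by
  refine ((integrable_const |ψ 0|).add (hX.abs.const_mul (M : ℝ))).mono'
    (hψ.continuous.comp_aestronglyMeasurable hX.1) (.of_forall fun ω => ?_)
  simpa using hψ.abs_le_add_mul 0 (X ω)

lemma integrable_id_gaussianReal_zero_one : Integrable (fun z : ℝ => z) (gaussianReal 0 1) := by
  simpa using integrable_pow_gaussianReal_zero_one 1

lemma LipschitzWith.integrable_mul_of_abs_le_exp {M : NNReal} {ψ h : ℝ → ℝ}
    (hψ : LipschitzWith M ψ) (hh : Continuous h) {C : ℝ}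
    (hC : ∀ u, |h u| ≤ C * exp (-u ^ 2 / 4)) : Integrable (fun u => ψ u * h u) := by
  refine ((integrable_add_mul_abs_mul_exp (b := 1 / 4) (by norm_num) |ψ 0| M 0).const_mul C).mono'
    (hψ.continuous.mul hh).aestronglyMeasurable (.of_forall fun u => ?_)
  rw [norm_mul]
  calc |ψ u| * |h u| ≤ (|ψ 0| + M * |u - 0|) * (C * exp (-u ^ 2 / 4)) :=
        mul_le_mul (hψ.abs_le_add_mul 0 u) (hC u) (abs_nonneg _) (by positivity)
    _ = _ := by ring_nf

lemma LipschitzWith.exists_taylor_gaussianReal {M : NNReal} {ψ : ℝ → ℝ} (hψ : LipschitzWith M ψ) :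
    ∃ m k : ℝ, ∀ x, |∫ z, ψ (x + z) ∂gaussianReal 0 1 - ∫ z, ψ z ∂gaussianReal 0 1
      - m * x - k * x ^ 2| ≤ M * |x| ^ 3 / 3 := by
  set ρ := gaussianPDFReal 0 1 with hρ
  have hρ' : ∀ u, HasDerivAt ρ (-(u * ρ u)) u := hasDerivAt_gaussianPDFReal_zero_one
  have hρc : Continuous ρ := continuous_iff_continuousAt.2 fun u => (hρ' u).continuousAt
  have b0 : ∀ u, |ρ u| ≤ 4 * exp (-u ^ 2 / 4) := fun u => by
    simpa using abs_mul_gaussianPDFReal_le (p := 1) (x := u) (C := 4)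
      (by rw [abs_one]; nlinarith [sq_nonneg u]) (by norm_num)
  have b1 : ∀ u, |u * ρ u| ≤ 4 * exp (-u ^ 2 / 4) := fun u =>
    abs_mul_gaussianPDFReal_le (by rw [← sq_abs]; nlinarith [sq_nonneg (|u| - 1)]) (by norm_num)
  have b2 : ∀ u, |(u ^ 2 - 1) * ρ u| ≤ 4 * exp (-u ^ 2 / 4) := fun u =>
    abs_mul_gaussianPDFReal_le (by rw [abs_le]; constructor <;> nlinarith [sq_nonneg u])
      (by norm_num)
  have d0 : ∀ x, HasDerivAt (fun x => ∫ y, ψ y * ρ (y - x))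
      (∫ y, ψ y * ((y - x) * ρ (y - x))) x := fun x => by
    have := hasDerivAt_integral_mul_comp_sub hψ hρ' (by fun_prop) b0
      (fun u => by rw [abs_neg]; exact b1 u) x
    simpa [integral_neg] using this
  have d1 : ∀ x, HasDerivAt (fun x => ∫ y, ψ y * ((y - x) * ρ (y - x)))
      (∫ y, ψ y * (((y - x) ^ 2 - 1) * ρ (y - x))) x := fun x => by
    have := hasDerivAt_integral_mul_comp_sub hψ (q := fun u => u * ρ u)
      (q' := fun u => -((u ^ 2 - 1) * ρ u))
      (fun u => ((hasDerivAt_id u).mul (hρ' u)).congr_deriv (by simp only [id]; ring)) (by fun_prop)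
      b1 (fun u => by rw [abs_neg]; exact b2 u) x
    simpa only [mul_neg, integral_neg, neg_neg] using this
  have shift : ∀ (h : ℝ → ℝ) x, ∫ y, ψ y * h (y - x) = ∫ u, ψ (u + x) * h u := fun h x => by
    simpa using integral_sub_right_eq_self (μ := volume) (fun u => ψ (u + x) * h u) x
  have hψx : ∀ x, LipschitzWith M fun u => ψ (u + x) := fun x => by
    simpa [Function.comp_def] using hψ.comp (LipschitzWith.id.add (LipschitzWith.const x))
  have hg : ∀ x, ∫ z, ψ (x + z) ∂gaussianReal 0 1 = ∫ y, ψ y * ρ (y - x) := fun x => by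
    rw [shift, integral_gaussianReal_eq_integral_smul one_ne_zero]
    simp only [smul_eq_mul, mul_comm, add_comm, hρ]
  have i2 := integrable_gaussianReal_zero_one_iff.1
    ((integrable_pow_gaussianReal_zero_one 2).add (integrable_const (1 : ℝ)))
  have hK : ∀ x, |(∫ y, ψ y * (((y - x) ^ 2 - 1) * ρ (y - x)))
      - ∫ y, ψ y * (((y - 0) ^ 2 - 1) * ρ (y - 0))| ≤ 2 * M * |x| := fun x => by
    have hi := fun x => (hψx x).integrable_mul_of_abs_le_exp (by fun_prop) b2
    rw [shift (fun u => (u ^ 2 - 1) * ρ u), shift (fun u => (u ^ 2 - 1) * ρ u),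
      ← integral_sub (hi x) (hi 0)]
    have h2 : ∫ u, (u ^ 2 + 1) * ρ u = 2 := by
      have : ∫ u, (u ^ 2 + 1) ∂gaussianReal 0 1 = 2 := by
        rw [integral_add (integrable_pow_gaussianReal_zero_one 2) (integrable_const _),
          integral_sq_gaussianReal_zero_one]
        norm_num
      rw [integral_gaussianReal_eq_integral_smul one_ne_zero] at this
      simpa only [smul_eq_mul, mul_comm] using this
    calc _ ≤ ∫ u, M * |x| * ((u ^ 2 + 1) * ρ u) := by
          rw [← Real.norm_eq_abs]
          refine norm_integral_le_of_norm_le (i2.const_mul _) (.of_forall fun u => ?_)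
          rw [← sub_mul, norm_mul, norm_mul, Real.norm_of_nonneg (gaussianPDFReal_nonneg _ _ _)]
          refine mul_le_mul ?_ (mul_le_mul_of_nonneg_right ?_ (gaussianPDFReal_nonneg _ _ _))
            (mul_nonneg (norm_nonneg _) (gaussianPDFReal_nonneg _ _ _)) (by positivity)
          · simpa [Real.dist_eq] using hψ.dist_le_mul (u + x) (u + 0)
          · rw [Real.norm_eq_abs, abs_le]
            constructor <;> nlinarith [sq_nonneg u]
      _ = _ := by rw [integral_const_mul, h2]; ring
  refine ⟨∫ y, ψ y * ((y - 0) * ρ (y - 0)), (∫ y, ψ y * (((y - 0) ^ 2 - 1) * ρ (y - 0))) / 2,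
    fun x => ?_⟩
  have h0 := hg 0
  simp only [zero_add] at h0
  rw [hg x, h0]
  convert abs_sub_taylor_two_le d0 d1 hK x using 1
  · congr 1; ring
  · ring

lemma LipschitzWith.exists_taylor_gaussianReal_mul {L : NNReal} {φ : ℝ → ℝ}
    (hφ : LipschitzWith L φ) {s : ℝ} (hs : 0 < s) (w : ℝ) :
    ∃ m k : ℝ, ∀ x, |∫ z, φ (w + x + s * z) ∂gaussianReal 0 1
      - ∫ z, φ (w + 0 + s * z) ∂gaussianReal 0 1 - m * x - k * x ^ 2|
        ≤ L / (3 * s ^ 2) * |x| ^ 3 := by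
  have hψ : LipschitzWith (L * ‖s‖₊) fun z => φ (w + s * z) := by
    refine hφ.comp (LipschitzWith.of_dist_le_mul fun x y => ?_)
    simp [Real.dist_eq, ← mul_sub, abs_mul]
  obtain ⟨m, k, h⟩ := hψ.exists_taylor_gaussianReal
  refine ⟨m / s, k / s ^ 2, fun x => ?_⟩
  have e : ∀ z, w + s * (x / s + z) = w + x + s * z := fun z => by field_simp; ring
  have := h (x / s)
  simp only [e] at this
  convert this using 1
  · simp only [add_zero]
    congr 1; ring
  · rw [abs_div, abs_of_pos hs, NNReal.coe_mul, coe_nnnorm, Real.norm_of_nonneg hs.le]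
    field_simp

lemma nonneg_of_taylor_of_convexOn {H : ℝ → ℝ} (hH : ConvexOn ℝ univ H) {m k B : ℝ} (hB : 0 ≤ B)
    (h : ∀ x, |H x - H 0 - m * x - k * x ^ 2| ≤ B * |x| ^ 3) : 0 ≤ k := by
  by_contra! hk
  have hx : 0 < -k / (B + 1) := div_pos (by linarith) (by linarith)
  set x := -k / (B + 1) with hx'
  have hxB : x * (B + 1) = -k := by rw [hx']; field_simp
  have h1 := (abs_le.1 (h x)).2
  have h2 := (abs_le.1 (h (-x))).2
  have h3 := hH.2 (mem_univ x) (mem_univ (-x)) (by norm_num : (0 : ℝ) ≤ 1 / 2)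
    (by norm_num : (0 : ℝ) ≤ 1 / 2) (by norm_num)
  simp only [smul_eq_mul] at h3
  rw [show 1 / 2 * x + 1 / 2 * -x = 0 by ring] at h3
  rw [abs_of_pos hx] at h1
  rw [abs_neg, abs_of_pos hx] at h2
  nlinarith [pow_pos hx 3, pow_pos hx 2]

lemma LipschitzWith.integrable_gaussianReal_mul {L : NNReal} {φ : ℝ → ℝ} (hφ : LipschitzWith L φ)
    (s w : ℝ) :
    Integrable (fun z => φ (w + s * z)) (gaussianReal 0 1) :=
  hφ.integrable_comp ((integrable_const w).add (integrable_id_gaussianReal_zero_one.const_mul s))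

lemma LipschitzWith.integral_gaussianReal_mul {L : NNReal} {φ : ℝ → ℝ} (hφ : LipschitzWith L φ)
    (s w : ℝ) :
    LipschitzWith L fun x => ∫ z, φ (w + x + s * z) ∂gaussianReal 0 1 := by
  refine LipschitzWith.of_dist_le_mul fun x y => ?_
  rw [dist_eq_norm, ← integral_sub (hφ.integrable_gaussianReal_mul s _)
    (hφ.integrable_gaussianReal_mul s _)]
  refine (norm_integral_le_of_norm_le_const (C := L * dist x y) (.of_forall fun z => ?_)).trans_eq
    (by simp)
  rw [← dist_eq_norm]
  simpa using hφ.dist_le_mul (w + x + s * z) (w + y + s * z)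

lemma ConvexOn.integral_gaussianReal_mul {L : NNReal} {φ : ℝ → ℝ} (hc : ConvexOn ℝ univ φ)
    (hφ : LipschitzWith L φ) (s w : ℝ) :
    ConvexOn ℝ univ fun x => ∫ z, φ (w + x + s * z) ∂gaussianReal 0 1 := by
  refine ⟨convex_univ, fun x _ y _ a b ha hb hab => ?_⟩
  have hi := hφ.integrable_gaussianReal_mul s
  simp only [smul_eq_mul]
  rw [← integral_const_mul, ← integral_const_mul,
    ← integral_add ((hi _).const_mul _) ((hi _).const_mul _)]
  refine integral_mono (hi _) (((hi _).const_mul _).add ((hi _).const_mul _)) fun z => ?_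
  have := hc.2 (mem_univ (w + x + s * z)) (mem_univ (w + y + s * z)) ha hb hab
  simp only [smul_eq_mul] at this
  convert this using 2
  linear_combination (-(w + s * z)) * hab

lemma LipschitzWith.integral_gaussianReal_sqrt_add {L : NNReal} {φ : ℝ → ℝ} (hφ : LipschitzWith L φ)
    (s w : ℝ) {a : ℝ} (ha : 0 ≤ a) :
    ∫ z, φ (w + √(s ^ 2 + a) * z) ∂gaussianReal 0 1 =
      ∫ y, ∫ z, φ (w + √a * y + s * z) ∂gaussianReal 0 1 ∂gaussianReal 0 1 := by
  have hmap : ∀ c : ℝ, (gaussianReal 0 1).map (c * ·) = gaussianReal 0 (.mk (c ^ 2) (sq_nonneg c)) :=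
    fun c => by rw [gaussianReal_map_const_mul]; simp
  have hmeas : Measurable fun z => φ (w + z) := by
    have := hφ.continuous
    fun_prop
  have hconv : gaussianReal 0 (.mk (√(s ^ 2 + a) ^ 2) (sq_nonneg _)) =
      gaussianReal 0 (.mk (√a ^ 2) (sq_nonneg _)) ∗ gaussianReal 0 (.mk (s ^ 2) (sq_nonneg _)) := by
    rw [gaussianReal_conv_gaussianReal, add_zero]
    congr 1
    ext
    simp only [NNReal.coe_mk, NNReal.coe_add]
    rw [Real.sq_sqrt (by positivity), Real.sq_sqrt ha, add_comm]
  have hint : Integrable (fun z => φ (w + z)) (gaussianReal 0 (.mk (√(s ^ 2 + a) ^ 2) (sq_nonneg _))) := by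
    rw [← hmap, integrable_map_measure hmeas.aestronglyMeasurable (by fun_prop)]
    exact hφ.integrable_gaussianReal_mul _ w
  have h1 : ∫ z, φ (w + √(s ^ 2 + a) * z) ∂gaussianReal 0 1 =
      ∫ z, φ (w + z) ∂gaussianReal 0 (.mk (√(s ^ 2 + a) ^ 2) (sq_nonneg _)) := by
    rw [← hmap, integral_map (by fun_prop) hmeas.aestronglyMeasurable]
  rw [h1]
  rw [hconv] at hint ⊢
  rw [integral_conv hint, ← hmap, ← hmap, integral_map (by fun_prop)]
  · refine integral_congr_ae (.of_forall fun y => ?_)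
    dsimp only
    rw [integral_map (by fun_prop)]
    · simp only [add_assoc]
    · exact (hmeas.comp (measurable_const_add _)).aestronglyMeasurable
  · have := hφ.continuous
    refine StronglyMeasurable.aestronglyMeasurable ?_
    refine StronglyMeasurable.integral_prod_right (f := fun x y => φ (w + (x + y))) ?_
    exact (by fun_prop : Continuous _).stronglyMeasurable

section Moments

variable {Ω : Type*} [MeasurableSpace Ω] {μ : Measure Ω} [IsProbabilityMeasure μ] {X : Ω → ℝ}

lemma integral_abs_le_sqrt_of_integral_sq_le {a : ℝ} (ha : 0 < a) (hX : Integrable X μ)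
    (hX2 : Integrable (fun ω => X ω ^ 2) μ) (h : ∫ ω, X ω ^ 2 ∂μ ≤ a) : ∫ ω, |X ω| ∂μ ≤ √a := by
  have hs := Real.sqrt_pos.2 ha
  have hsq := Real.sq_sqrt ha.le
  calc ∫ ω, |X ω| ∂μ ≤ ∫ ω, (X ω ^ 2 + a) / (2 * √a) ∂μ := by
        refine integral_mono hX.abs ((hX2.add (integrable_const _)).div_const _) fun ω => ?_
        dsimp only
        rw [le_div_iff₀ (by positivity), ← sq_abs]
        nlinarith [sq_nonneg (|X ω| - √a)]
    _ = (∫ ω, X ω ^ 2 ∂μ + a) / (2 * √a) := by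
        rw [integral_div, integral_add hX2 (integrable_const _)]
        simp
    _ ≤ √a := by
        rw [div_le_iff₀ (by positivity)]
        nlinarith

lemma integral_sq_le_integral_abs_cube {c : ℝ} (hc : 0 < c)
    (hX2 : Integrable (fun ω => X ω ^ 2) μ) (hX3 : Integrable (fun ω => |X ω| ^ 3) μ) :
    ∫ ω, X ω ^ 2 ∂μ ≤ 2 / (3 * c) * ∫ ω, |X ω| ^ 3 ∂μ + c ^ 2 / 3 := by
  calc ∫ ω, X ω ^ 2 ∂μ ≤ ∫ ω, (2 / (3 * c) * |X ω| ^ 3 + c ^ 2 / 3) ∂μ := by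
        refine integral_mono hX2 ((hX3.const_mul _).add (integrable_const _)) fun ω => ?_
        have hx := abs_nonneg (X ω)
        dsimp only
        rw [← sq_abs]
        generalize |X ω| = x at hx
        have : 2 / (3 * c) * x ^ 3 + c ^ 2 / 3 - x ^ 2 = (x - c) ^ 2 * (2 * x + c) / (3 * c) := by
          field_simp
          ring
        have : 0 ≤ (x - c) ^ 2 * (2 * x + c) / (3 * c) := by positivity
        linarith
    _ = _ := by
        rw [integral_add (hX3.const_mul _) (integrable_const _), integral_const_mul]
        simp

lemma LipschitzWith.abs_integral_sub_le {L : NNReal} {H : ℝ → ℝ} (hH : LipschitzWith L H)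
    (hX : Integrable X μ) : |∫ ω, H (X ω) ∂μ - H 0| ≤ L * ∫ ω, |X ω| ∂μ := by
  have h : ∫ ω, H (X ω) ∂μ - H 0 = ∫ ω, (H (X ω) - H 0) ∂μ := by
    rw [integral_sub (hH.integrable_comp hX) (integrable_const _)]
    simp
  rw [h, ← integral_const_mul, ← Real.norm_eq_abs]
  refine norm_integral_le_of_norm_le (hX.abs.const_mul _) (.of_forall fun ω => ?_)
  simpa [Real.dist_eq] using hH.dist_le_mul (X ω) 0

lemma abs_integral_sub_taylor_le {H : ℝ → ℝ} {m k B : ℝ}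
    (h : ∀ x, |H x - H 0 - m * x - k * x ^ 2| ≤ B * |x| ^ 3)
    (hHX : Integrable (fun ω => H (X ω)) μ) (hX : Integrable X μ)
    (hX2 : Integrable (fun ω => X ω ^ 2) μ) (hX3 : Integrable (fun ω => |X ω| ^ 3) μ)
    (h0 : ∫ ω, X ω ∂μ = 0) :
    |∫ ω, H (X ω) ∂μ - (H 0 + k * ∫ ω, X ω ^ 2 ∂μ)| ≤ B * ∫ ω, |X ω| ^ 3 ∂μ := by
  have e : ∫ ω, H (X ω) ∂μ - (H 0 + k * ∫ ω, X ω ^ 2 ∂μ) =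
      ∫ ω, (H (X ω) - H 0 - m * X ω - k * X ω ^ 2) ∂μ := by
    have i1 : Integrable (fun ω => H (X ω) - H 0) μ := hHX.sub (integrable_const _)
    have i2 : Integrable (fun ω => H (X ω) - H 0 - m * X ω) μ := i1.sub (hX.const_mul m)
    rw [integral_sub i2 (hX2.const_mul k), integral_sub i1 (hX.const_mul m),
      integral_sub hHX (integrable_const _), integral_const_mul, integral_const_mul, h0]
    simp
    ring
  rw [e, ← integral_const_mul, ← Real.norm_eq_abs]
  exact norm_integral_le_of_norm_le (hX3.const_mul _) (.of_forall fun ω => h _)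

end Moments

lemma abs_ciSup_sub_le {ι : Type*} [Nonempty ι] {u v : ι → ℝ} {c k R : ℝ} (hk : 0 ≤ k)
    (hv : BddAbove (range v)) (h : ∀ i, |u i - (c + k * v i)| ≤ R) :
    |(⨆ i, u i) - (c + k * ⨆ i, v i)| ≤ R := by
  have hu : ∀ i, u i ≤ c + k * (⨆ i, v i) + R := fun i => by
    have := mul_le_mul_of_nonneg_left (le_ciSup hv i) hk
    linarith [(abs_le.1 (h i)).2]
  have hub : BddAbove (range u) := ⟨_, forall_mem_range.2 hu⟩
  rw [abs_le]
  constructor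
  · have : k * (⨆ i, v i) ≤ (⨆ i, u i) - c + R := by
      rw [Real.mul_iSup_of_nonneg hk]
      refine ciSup_le fun i => ?_
      linarith [(abs_le.1 (h i)).1, le_ciSup hub i]
    linarith
  · linarith [ciSup_le hu]

/-- One-step smoothing estimate for convex Lipschitz test functions: with
`(φ ∗ ϕ_σ)(w) = E[φ(w + σZ)]` (which also realizes the convention `φ ∗ ϕ_0 = φ`),
if `𝔼[ξ] = −𝔼[−ξ] = 0` and `𝔼[ξ²] = a > 0` then
`|𝔼[(φ ∗ ϕ_s)(w + ξ)] − (φ ∗ ϕ_{√(s²+a)})(w)| ≤ ‖φ'‖(2a^{3/2} + 𝔼|ξ|³)/(s² + a)`. -/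
theorem stmt14 {Ω Θ : Type*} [MeasurableSpace Ω] [Nonempty Θ]
    (P : Θ → Measure Ω) (hP : ∀ θ, IsProbabilityMeasure (P θ))
    (ξ : Ω → ℝ)
    (hInt : ∀ θ, Integrable ξ (P θ))
    (hInt2 : ∀ θ, Integrable (fun ω => ξ ω ^ 2) (P θ))
    (hInt3 : ∀ θ, Integrable (fun ω => |ξ ω| ^ 3) (P θ))
    (hBdd3 : BddAbove (Set.range fun θ => ∫ ω, |ξ ω| ^ 3 ∂(P θ)))
    (hmean : SE P ξ = 0) (hmean' : SE P (fun ω => -ξ ω) = 0)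
    (a : ℝ) (ha : 0 < a) (hvar : SE P (fun ω => ξ ω ^ 2) = a)
    (φ : ℝ → ℝ) (L : NNReal) (hconv : ConvexOn ℝ Set.univ φ) (hlip : LipschitzWith L φ)
    (s : ℝ) (hs : 0 ≤ s) (w : ℝ) :
    |SE P (fun ω => ∫ z, φ (w + ξ ω + s * z) ∂(ProbabilityTheory.gaussianReal 0 1)) -
        ∫ z, φ (w + Real.sqrt (s ^ 2 + a) * z) ∂(ProbabilityTheory.gaussianReal 0 1)|
      ≤ L * (2 * Real.sqrt a ^ 3 + SE P (fun ω => |ξ ω| ^ 3)) / (s ^ 2 + a) := by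
  have hbdd : ∀ f : Ω → ℝ, (∀ θ, Integrable f (P θ)) → (∀ ω, f ω ≤ 1 + |ξ ω| ^ 3) →
      BddAbove (Set.range fun θ => ∫ ω, f ω ∂(P θ)) := by
    obtain ⟨C, hC⟩ := hBdd3
    refine fun f hf hle => ⟨1 + C, forall_mem_range.2 fun θ => ?_⟩
    have := hP θ
    calc ∫ ω, f ω ∂(P θ) ≤ ∫ ω, (1 + |ξ ω| ^ 3) ∂(P θ) :=
          integral_mono (hf θ) ((integrable_const _).add (hInt3 θ)) hle
      _ = 1 + ∫ ω, |ξ ω| ^ 3 ∂(P θ) := by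
          rw [integral_add (integrable_const _) (hInt3 θ)]
          simp
      _ ≤ 1 + C := by linarith [hC (mem_range_self θ)]
  have habs : ∀ x : ℝ, |x| ≤ 1 + |x| ^ 3 := fun x => by
    have := abs_nonneg x
    nlinarith [mul_nonneg this (sq_nonneg (|x| - 1)), sq_nonneg (|x| - 1)]
  have hsqc : ∀ x : ℝ, x ^ 2 ≤ 1 + |x| ^ 3 := fun x => by
    have := abs_nonneg x
    rw [← sq_abs]
    nlinarith [mul_nonneg this (sq_nonneg (|x| - 1)), sq_nonneg (|x| - 1)]
  have hbdd2 := hbdd _ hInt2 fun ω => hsqc (ξ ω)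
  have hmean0 : ∀ θ, ∫ ω, ξ ω ∂(P θ) = 0 := fun θ => by
    have h1 := le_ciSup (hbdd ξ hInt fun ω => (le_abs_self _).trans (habs _)) θ
    have h2 := le_ciSup (hbdd (fun ω => -ξ ω) (fun θ => (hInt θ).neg)
      fun ω => (neg_le_abs _).trans (habs _)) θ
    have h1' := h1.trans_eq hmean
    have h2' := h2.trans_eq hmean'
    rw [integral_neg] at h2'
    linarith
  have hvarle : ∀ θ, ∫ ω, ξ ω ^ 2 ∂(P θ) ≤ a := fun θ => (le_ciSup hbdd2 θ).trans_eq hvar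
  have hcube : ∀ θ, ∫ ω, |ξ ω| ^ 3 ∂(P θ) ≤ SE P (fun ω => |ξ ω| ^ 3) := le_ciSup hBdd3
  set β := SE P (fun ω => |ξ ω| ^ 3)
  have hr : 0 < √a := Real.sqrt_pos.2 ha
  have hra : √a ^ 2 = a := Real.sq_sqrt ha.le
  have hβ : √a ^ 3 ≤ β := by
    have h : a ≤ 2 / (3 * √a) * β + √a ^ 2 / 3 := by
      rw [← hvar]
      refine ciSup_le fun θ => ?_
      have := hP θ
      rw [hvar]
      refine (integral_sq_le_integral_abs_cube hr (hInt2 θ) (hInt3 θ)).trans ?_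
      gcongr
      exact hcube θ
    have h' : 2 / (3 * √a) * β * (3 * √a) = 2 * β := by field_simp
    nlinarith
  set H : ℝ → ℝ := fun x => ∫ z, φ (w + x + s * z) ∂gaussianReal 0 1 with hHdef
  have hH : LipschitzWith L H := hlip.integral_gaussianReal_mul s w
  rw [hlip.integral_gaussianReal_sqrt_add s w ha.le]
  change |(⨆ θ, ∫ ω, H (ξ ω) ∂(P θ)) - ∫ y, H (√a * y) ∂gaussianReal 0 1| ≤ _
  have gi : Integrable (fun y => √a * y) (gaussianReal 0 1) :=
    integrable_id_gaussianReal_zero_one.const_mul _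
  have gi2 : Integrable (fun y => (√a * y) ^ 2) (gaussianReal 0 1) := by
    simpa only [mul_pow] using (integrable_pow_gaussianReal_zero_one 2).const_mul (√a ^ 2)
  have g2 : ∫ y, (√a * y) ^ 2 ∂gaussianReal 0 1 = a := by
    simp only [mul_pow]
    rw [integral_const_mul, integral_sq_gaussianReal_zero_one, hra, mul_one]
  have hL : (0 : ℝ) ≤ L := L.2
  rcases le_or_gt a (2 * s ^ 2) with hcase | hcase
  · have hs0 : 0 < s := hs.lt_of_ne fun h => by
      rw [← h] at hcase
      norm_num at hcase
      linarith
    obtain ⟨m, k, hT⟩ := hlip.exists_taylor_gaussianReal_mul hs0 w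
    have hk : 0 ≤ k := nonneg_of_taylor_of_convexOn
      (hconv.integral_gaussianReal_mul hlip s w) (by positivity) hT
    have gi3 : Integrable (fun y => |√a * y| ^ 3) (gaussianReal 0 1) := by
      simpa only [abs_mul, mul_pow] using
        integrable_abs_cube_gaussianReal_zero_one.const_mul (|√a| ^ 3)
    have g3 : ∫ y, |√a * y| ^ 3 ∂gaussianReal 0 1 ≤ 2 * √a ^ 3 := by
      simp only [abs_mul, mul_pow]
      rw [integral_const_mul, abs_of_pos hr, mul_comm]
      exact mul_le_mul_of_nonneg_right integral_abs_cube_gaussianReal_zero_one_le (by positivity)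
    have hG := abs_integral_sub_taylor_le hT (hH.integrable_comp gi) gi gi2 gi3
      (by rw [integral_const_mul, integral_id_gaussianReal, mul_zero])
    have hB : 0 ≤ L / (3 * s ^ 2) := by positivity
    have hsup := abs_ciSup_sub_le (R := L / (3 * s ^ 2) * β) hk hbdd2 fun θ => by
      have := hP θ
      exact (abs_integral_sub_taylor_le hT (hH.integrable_comp (hInt θ)) (hInt θ) (hInt2 θ)
        (hInt3 θ) (hmean0 θ)).trans (mul_le_mul_of_nonneg_left (hcube θ) hB)
    rw [show (⨆ θ, ∫ ω, ξ ω ^ 2 ∂(P θ)) = a from hvar] at hsup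
    rw [g2, abs_sub_comm] at hG
    refine (abs_sub_le _ _ _).trans ((add_le_add hsup
      (hG.trans (mul_le_mul_of_nonneg_left g3 hB))).trans ?_)
    rw [← mul_add, div_mul_eq_mul_div, add_comm β]
    have hβ0 : 0 ≤ β := (by positivity : 0 ≤ √a ^ 3).trans hβ
    gcongr
    linarith
  · have hG := (hH.abs_integral_sub_le gi).trans (mul_le_mul_of_nonneg_left
      (integral_abs_le_sqrt_of_integral_sq_le ha gi gi2 g2.le) hL)
    have hsup := abs_ciSup_sub_le (k := 0) (c := H 0) (R := L * √a) le_rfl hbdd2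
      (u := fun θ => ∫ ω, H (ξ ω) ∂(P θ)) fun θ => by
        have := hP θ
        rw [zero_mul, add_zero]
        exact (hH.abs_integral_sub_le (hInt θ)).trans (mul_le_mul_of_nonneg_left
          (integral_abs_le_sqrt_of_integral_sq_le ha (hInt θ) (hInt2 θ) (hvarle θ)) hL)
    rw [zero_mul, add_zero] at hsup
    rw [abs_sub_comm] at hG
    refine (abs_sub_le _ _ _).trans ((add_le_add hsup hG).trans ?_)
    rw [le_div_iff₀ (by positivity), ← mul_add, mul_assoc]
    refine mul_le_mul_of_nonneg_left ?_ hL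
    nlinarith
end
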